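/- arXiv:2511.02955 — 4 statements merged into one kernel-verified Lean document; each statement's English description precedes it below -/
import Mathlib

section
/- Let K ≥ 2 and let M ⊂ (0,∞) be a set of r distinct positive real numbers with r ≥ K−1. If p = (p_1,…,p_K) and q = (q_1,…,q_K) are probability vectors with all entries strictly positive, and H_m(p) = H_m(q) for every m ∈ M, then q is a permutation of p. In other words, the map sending p to (H_m(p))_{m ∈ M} is injective up to permutation on the open simplex. -/
/-- Generalized Shannon's Entropy (GSE) of order `m` of a probability vector `p` on `Fin K`:
`H_m(p) = -∑ k, (p k ^ m / ∑ i, p i ^ m) * log (p k ^ m / ∑ i, p i ^ m)`. -/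
noncomputable def GSE (K : ℕ) (m : ℝ) (p : Fin K → ℝ) : ℝ :=
  -∑ k, (p k ^ m / ∑ i, p i ^ m) * Real.log (p k ^ m / ∑ i, p i ^ m)

/-- `f` takes values of alternating strict signs along some strictly increasing sequence of
length `r`, the first of these signs being that of `s`. -/
def HasAlternation {α : Type*} [Preorder α] (f : α → ℝ) (r : ℕ) (s : ℝ) : Prop :=
  ∃ a : Fin r → α, StrictMono a ∧ ∀ i : Fin r, 0 < s * (-1) ^ (i : ℕ) * f (a i)

theorem strictMono_fin_cons {α : Type*} [Preorder α] {r : ℕ} {a : Fin r → α} {p : α}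
    (ha : StrictMono a) (hp : ∀ i, p < a i) :
    StrictMono (Fin.cons p a : Fin (r + 1) → α) := by
  intro i j hij
  induction j using Fin.cases with
  | zero => exact absurd hij (Fin.not_lt_zero i)
  | succ j =>
    induction i using Fin.cases with
    | zero => simpa using hp j
    | succ i => simpa using ha (Fin.succ_lt_succ_iff.mp hij)

theorem hasAlternation_zero {α : Type*} [Preorder α] (f : α → ℝ) (s : ℝ) :
    HasAlternation f 0 s :=
  ⟨Fin.elim0, fun i => i.elim0, fun i => i.elim0⟩

theorem hasAlternation_cons {α : Type*} [Preorder α] {f : α → ℝ} {r : ℕ} {s : ℝ} {p : α}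
    {a : Fin r → α} (ha : StrictMono a) (hs : ∀ i : Fin r, 0 < -s * (-1) ^ (i : ℕ) * f (a i))
    (hp : ∀ i, p < a i) (hps : 0 < s * f p) : HasAlternation f (r + 1) s := by
  refine ⟨Fin.cons p a, strictMono_fin_cons ha hp, fun i => ?_⟩
  induction i using Fin.cases with
  | zero => simpa using hps
  | succ i =>
    have := hs i
    simp only [Fin.val_succ, Fin.cons_succ, pow_succ]
    linarith

theorem HasAlternation.comp_strictMono {α β : Type*} [Preorder α] [Preorder β] {f : β → ℝ}
    {r : ℕ} {s : ℝ} {e : α → β} (he : StrictMono e) (h : HasAlternation (f ∘ e) r s) :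
    HasAlternation f r s := by
  obtain ⟨a, ha, hs⟩ := h
  exact ⟨e ∘ a, he.comp ha, hs⟩

theorem HasAlternation.exists_succ {α : Type*} [LinearOrder α] {f : α → ℝ} {r : ℕ} {s : ℝ}
    (hr : 0 < r) (h₁ : HasAlternation f r s) (h₂ : HasAlternation f r (-s)) :
    HasAlternation f (r + 1) s ∨ HasAlternation f (r + 1) (-s) := by
  obtain ⟨a, ha, has⟩ := h₁
  obtain ⟨b, hb, hbs⟩ := h₂
  have h0a := has ⟨0, hr⟩
  have h0b := hbs ⟨0, hr⟩
  simp only [pow_zero, mul_one] at h0a h0b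
  have hmin : ∀ {c : Fin r → α}, StrictMono c → ∀ i, c ⟨0, hr⟩ ≤ c i := fun hc i =>
    hc.monotone (by simp [Fin.le_def])
  rcases lt_trichotomy (a ⟨0, hr⟩) (b ⟨0, hr⟩) with h | h | h
  · exact .inl (hasAlternation_cons hb hbs (fun i => h.trans_le (hmin hb i)) h0a)
  · rw [h] at h0a
    linarith
  · exact .inr (hasAlternation_cons ha (by simpa using has)
      (fun i => h.trans_le (hmin ha i)) h0b)

theorem HasAlternation.le_card {ι : Type*} [Preorder ι] {f : ι → ℝ} {r : ℕ} {s : ℝ}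
    (h : HasAlternation f r s) (T : Finset ι) (hT : ∀ k ∉ T, f k = 0) : r ≤ T.card := by
  obtain ⟨a, ha, has⟩ := h
  have : (Finset.univ.map ⟨a, ha.injective⟩) ⊆ T := by
    intro k hk
    obtain ⟨i, -, rfl⟩ := Finset.mem_map.mp hk
    by_contra hk
    have := has i
    rw [show f (a i) = 0 from hT _ hk] at this
    simp at this
  simpa using Finset.card_le_card this

theorem exists_monotone_of_not_hasAlternation {n : ℕ} (d : Fin n → ℝ) {r : ℕ} {s : ℝ}
    (h : ¬ HasAlternation d r s) :
    ∃ j : Fin n → Fin r, Monotone j ∧ ∀ i, s * (-1) ^ (j i : ℕ) * d i ≤ 0 := by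
  induction n generalizing r s with
  | zero => exact ⟨Fin.elim0, fun i => i.elim0, fun i => i.elim0⟩
  | succ n ih =>
    obtain _ | r := r
    · exact absurd (hasAlternation_zero d s) h
    have hcons : ∀ {q : ℕ} (p : Fin q) (f : Fin n → Fin q), Monotone f → (∀ i, p ≤ f i) →
        Monotone (Fin.cons p f : Fin (n + 1) → Fin q) := by
      intro q p f hf hp i k hik
      induction i using Fin.cases with
      | zero => induction k using Fin.cases with
        | zero => exact le_rfl
        | succ k => simpa using hp k
      | succ i => induction k using Fin.cases with
        | zero => simp at hik
        | succ k => simpa using hf (Fin.succ_le_succ_iff.mp hik)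
    by_cases h0 : 0 < s * d 0
    · have h' : ¬ HasAlternation (d ∘ Fin.succ) r (-s) := by
        rintro ⟨a, ha, has⟩
        exact h (hasAlternation_cons ((Fin.strictMono_succ).comp ha) has
          (fun i => Fin.succ_pos _) h0)
      obtain ⟨j, hj, hjs⟩ := ih _ h'
      obtain _ | r := r
      · exact absurd (hasAlternation_zero _ _) h'
      refine ⟨Fin.cons 1 (Fin.succ ∘ j), hcons _ _ (Fin.strictMono_succ.monotone.comp hj)
        (fun i => by simp [Fin.le_def]), fun i => ?_⟩
      induction i using Fin.cases with
      | zero => simpa using h0.le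
      | succ i =>
        have := hjs i
        simp only [Function.comp_apply, Fin.cons_succ, Fin.val_succ, pow_succ] at this ⊢
        linarith
    · have h' : ¬ HasAlternation (d ∘ Fin.succ) (r + 1) s := fun h1 =>
        h (h1.comp_strictMono Fin.strictMono_succ)
      obtain ⟨j, hj, hjs⟩ := ih _ h'
      refine ⟨Fin.cons 0 j, hcons _ _ hj (fun i => Fin.zero_le _), fun i => ?_⟩
      induction i using Fin.cases with
      | zero => simpa using not_lt.mp h0
      | succ i => simpa using hjs i

/-- The sum `∑ i, w i * exp (m * x i)`. -/
noncomputable def expSum {n : ℕ} (w x : Fin n → ℝ) (m : ℝ) : ℝ :=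
  ∑ i, w i * Real.exp (m * x i)

/-- The numerator of the derivative of `expSum (w * h) x / expSum w x`. -/
noncomputable def ratioWronskian {n : ℕ} (w x h : Fin n → ℝ) (m : ℝ) : ℝ :=
  expSum (w * h * x) x m * expSum w x m - expSum (w * h) x m * expSum (w * x) x m

theorem hasDerivAt_expSum {n : ℕ} (w x : Fin n → ℝ) (m : ℝ) :
    HasDerivAt (expSum w x) (expSum (w * x) x m) m := by
  unfold expSum
  refine HasDerivAt.fun_sum fun i _ => ?_
  have := (((hasDerivAt_id m).mul_const (x i)).exp).const_mul (w i)
  refine this.congr_deriv ?_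
  simp only [id, Pi.mul_apply, one_mul]
  ring

theorem expSum_pos {n : ℕ} {w : Fin (n + 1) → ℝ} (hw : ∀ i, 0 < w i) (x : Fin (n + 1) → ℝ)
    (m : ℝ) : 0 < expSum w x m :=
  Finset.sum_pos (fun i _ => mul_pos (hw i) (Real.exp_pos _)) Finset.univ_nonempty

theorem expSum_sub_const {n : ℕ} (w x : Fin n → ℝ) (c m : ℝ) :
    expSum w (fun i => x i - c) m = Real.exp (-(m * c)) * expSum w x m := by
  simp only [expSum, Finset.mul_sum]
  refine Finset.sum_congr rfl fun i _ => ?_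
  rw [mul_left_comm, ← Real.exp_add]
  ring_nf

theorem tendsto_expSum_atBot {n : ℕ} (w x : Fin n → ℝ) (h : ∀ i, 0 < x i ∨ w i = 0) :
    Filter.Tendsto (expSum w x) Filter.atBot (nhds 0) := by
  have : Filter.Tendsto (fun m => ∑ i, w i * Real.exp (m * x i)) Filter.atBot
      (nhds (∑ i : Fin n, (0 : ℝ))) := by
    refine tendsto_finsetSum _ fun i _ => ?_
    rcases h i with hi | hi
    · have h1 : Filter.Tendsto (fun m : ℝ => Real.exp (m * x i)) Filter.atBot (nhds 0) :=
        Real.tendsto_exp_atBot.comp (Filter.tendsto_id.atBot_mul_const hi)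
      simpa using h1.const_mul (w i)
    · simp [hi]
  rwa [Finset.sum_const_zero] at this

theorem tendsto_expSum_ratio_atBot {n : ℕ} {w x h : Fin (n + 1) → ℝ} (hw : ∀ i, 0 < w i)
    (hx : Monotone x) (hh : ∀ i j, x i = x j → h i = h j) :
    Filter.Tendsto (fun m => expSum (w * h) x m / expSum w x m) Filter.atBot (nhds (h 0)) := by
  have hnum : Filter.Tendsto (expSum (fun i => w i * (h i - h 0)) (fun i => x i - x 0))
      Filter.atBot (nhds 0) := by
    refine tendsto_expSum_atBot _ _ fun i => ?_
    rcases (hx (Fin.zero_le i)).lt_or_eq with hi | hi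
    · exact .inl (sub_pos.mpr hi)
    · exact .inr (by simp [hh 0 i hi])
  have hden : ∀ m, w 0 ≤ expSum w (fun i => x i - x 0) m := fun m => by
    have := Finset.single_le_sum (f := fun i => w i * Real.exp (m * (x i - x 0)))
      (fun i _ => (mul_pos (hw i) (Real.exp_pos _)).le) (Finset.mem_univ 0)
    simpa [expSum] using this
  have hq : Filter.Tendsto (fun m => expSum (fun i => w i * (h i - h 0)) (fun i => x i - x 0) m /
      expSum w (fun i => x i - x 0) m) Filter.atBot (nhds 0) := by
    refine squeeze_zero_norm (a := fun m =>
      ‖expSum (fun i => w i * (h i - h 0)) (fun i => x i - x 0) m‖ / w 0) (fun m => ?_) ?_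
    · rw [norm_div, Real.norm_of_nonneg ((hw 0).le.trans (hden m))]
      exact div_le_div_of_nonneg_left (norm_nonneg _) (hw 0) (hden m)
    · simpa using hnum.norm.div_const (w 0)
  have := hq.add_const (h 0)
  rw [zero_add] at this
  refine this.congr fun m => ?_
  have hpos := expSum_pos hw x m
  rw [expSum_sub_const, expSum_sub_const, mul_div_mul_left _ _ (Real.exp_pos _).ne',
    div_add' _ _ _ hpos.ne']
  congr 1
  simp only [expSum, Finset.mul_sum, ← Finset.sum_add_distrib, Pi.mul_apply]
  exact Finset.sum_congr rfl fun i _ => by ring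

theorem ratioWronskian_sub_const {n : ℕ} (w x h : Fin n → ℝ) (c m : ℝ) :
    ratioWronskian w x h m =
      Real.exp (m * c) ^ 2 * ratioWronskian w (fun i => x i - c) h m := by
  have hlin : ∀ u : Fin n → ℝ, expSum (u * fun i => x i - c) x m =
      expSum (u * x) x m - c * expSum u x m := fun u => by
    simp only [expSum, Finset.mul_sum, ← Finset.sum_sub_distrib, Pi.mul_apply]
    exact Finset.sum_congr rfl fun i _ => by ring
  have hexp : Real.exp (m * c) * Real.exp (-(m * c)) = 1 := by
    rw [← Real.exp_add, add_neg_cancel, Real.exp_zero]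
  simp only [ratioWronskian, expSum_sub_const, hlin]
  linear_combination (-(Real.exp (m * c) * Real.exp (-(m * c))) - 1) *
    (expSum (w * h * x) x m * expSum w x m - expSum (w * h) x m * expSum (w * x) x m) * hexp

theorem expSum_succ {n : ℕ} (w x : Fin (n + 1) → ℝ) (m : ℝ) :
    expSum w x m = w 0 * Real.exp (m * x 0) + expSum (fun i => w i.succ) (fun i => x i.succ) m :=
  Fin.sum_univ_succ _

/-- Critical points of the quotient of two exponential sums, the denominator having positive
coefficients, obey Descartes' rule of signs for the increments of the quotients `h` of the
coefficients. -/
theorem hasAlternation_of_ratioWronskian {n : ℕ} {w x h : Fin (n + 1) → ℝ} (hw : ∀ i, 0 < w i)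
    (hx : Monotone x) (hh : ∀ i j, x i = x j → h i = h j)
    (hne : ∃ k : Fin n, h k.succ - h k.castSucc ≠ 0) {r : ℕ} {s : ℝ} (hs : s ≠ 0)
    {a : Fin r → ℝ} (ha : StrictMono a)
    (has : ∀ i : Fin r, 0 ≤ s * (-1) ^ (i : ℕ) * ratioWronskian w x h (a i)) :
    HasAlternation (fun k : Fin n => h k.succ - h k.castSucc) r s := by
  induction n generalizing r s with
  | zero => obtain ⟨k, -⟩ := hne; exact k.elim0
  | succ n ih =>
    obtain _ | r := r
    · exact hasAlternation_zero _ _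
    have hx' : Monotone fun i : Fin (n + 1) => x i.succ := hx.comp Fin.strictMono_succ.monotone
    rcases (hx (Fin.zero_le 1)).eq_or_lt with h01 | h01
    · -- the two smallest exponents agree: merge their terms
      set w' : Fin (n + 1) → ℝ := Fin.cons (w 0 + w 1) fun i => w i.succ.succ with hw'
      have hmerge : ∀ u : Fin (n + 2) → ℝ, (∀ i j, x i = x j → u i = u j) → ∀ m,
          expSum (w * u) x m = expSum (w' * fun i => u i.succ) (fun i => x i.succ) m := by
        intro u hu m
        have hu01 := hu 0 1 h01
        rw [expSum_succ, expSum_succ, expSum_succ (w' * _)]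
        simp only [Pi.mul_apply, hw', Fin.cons_zero, Fin.cons_succ, Fin.succ_zero_eq_one, h01, hu01]
        rw [← add_assoc]
        congr 1
        ring
      have hW : ∀ m, ratioWronskian w x h m =
          ratioWronskian w' (fun i => x i.succ) (fun i => h i.succ) m := by
        intro m
        have h1 := hmerge (h * x) (fun i j hij => by simp [hij, hh i j hij]) m
        have h2 := hmerge 1 (fun i j hij => rfl) m
        have h3 := hmerge h hh m
        have h4 := hmerge x (fun i j hij => hij) m
        simp only [mul_one, ← mul_assoc] at h1 h2
        rw [ratioWronskian, ratioWronskian, h1, h2, h3, h4]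
        congr 2
        · congr 1
          ext i
          simp [mul_assoc]
        · congr 1
          ext i
          simp
      have hw'pos : ∀ i, 0 < w' i := fun i => by
        induction i using Fin.cases with
        | zero => simpa [hw'] using add_pos (hw 0) (hw 1)
        | succ i => simpa [hw'] using hw _
      have hne' : ∃ k : Fin n, h k.succ.succ - h k.castSucc.succ ≠ 0 := by
        obtain ⟨k, hk⟩ := hne
        induction k using Fin.cases with
        | zero => exact absurd (sub_eq_zero.mpr (hh 0 1 h01).symm) hk
        | succ k => exact ⟨k, by simpa using hk⟩
      have := ih (h := fun i => h i.succ) hw'pos hx' (fun i j hij => hh _ _ hij) hne' hs ha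
        (fun i => by rw [← hW]; exact has i)
      exact HasAlternation.comp_strictMono (f := fun k : Fin (n + 1) => h k.succ - h k.castSucc)
        Fin.strictMono_succ this
    · set z : Fin (n + 2) → ℝ := fun i => x i - x 0 with hz
      set y : Fin (n + 1) → ℝ := fun i => z i.succ with hy
      set u : Fin (n + 1) → ℝ := fun i => w i.succ * y i with hu
      set g : Fin (n + 1) → ℝ := fun i => h i.succ with hg
      have hypos : ∀ i, 0 < y i := fun i => sub_pos.mpr (h01.trans_le (hx' (Fin.zero_le i)))
      have hupos : ∀ i, 0 < u i := fun i => mul_pos (hw _) (hypos i)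
      have hymono : Monotone y := fun i j hij => sub_le_sub_right (hx' hij) _
      have hgy : ∀ i j, y i = y j → g i = g j := fun i j hij => hh _ _ (sub_left_inj.mp hij)
      have hz0 : z 0 = 0 := sub_self _
      have hSd : ∀ m, expSum (w * z) z m = expSum u y m := fun m => by
        rw [expSum_succ]; simp [hz0]; rfl
      have hNd : ∀ m, expSum (w * h * z) z m = expSum (u * g) y m := fun m => by
        rw [expSum_succ]
        simp only [Pi.mul_apply, hz0, mul_zero, zero_mul, zero_add]
        refine Finset.sum_congr rfl fun i _ => ?_
        simp only [Pi.mul_apply, hu, hg, hy]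
        ring
      have hP : ∀ m, 0 < expSum u y m := expSum_pos hupos y
      have hS : ∀ m, 0 < expSum w z m := expSum_pos hw z
      let G : ℝ → ℝ := fun m =>
        expSum (u * g) y m / expSum u y m * expSum w z m - expSum (w * h) z m
      have hGW : ∀ m, ratioWronskian w x h m =
          Real.exp (m * x 0) ^ 2 * expSum u y m * G m := fun m => by
        have := (hP m).ne'
        rw [ratioWronskian_sub_const w x h (x 0), ratioWronskian, ← hz, hSd, hNd]
        simp only [G]
        field_simp
      have hGs : ∀ i : Fin (r + 1), 0 ≤ s * (-1) ^ (i : ℕ) * G (a i) := fun i => by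
        have h1 := has i
        rw [hGW, mul_left_comm] at h1
        exact nonneg_of_mul_nonneg_right h1 (mul_pos (pow_pos (Real.exp_pos _) 2) (hP _))
      have hGd : ∀ m,
          HasDerivAt G (expSum w z m / expSum u y m ^ 2 * ratioWronskian u y g m) m := by
        intro m
        have h1 := (((hasDerivAt_expSum (u * g) y m).div (hasDerivAt_expSum u y m)
          (hP m).ne').mul (hasDerivAt_expSum w z m)).sub (hasDerivAt_expSum (w * h) z m)
        refine h1.congr_deriv ?_
        have := (hP m).ne'
        rw [hSd, hNd, ratioWronskian, Pi.div_apply]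
        field_simp
        ring
      have hsgn : ∀ (t m : ℝ), 0 ≤ t * (expSum w z m / expSum u y m ^ 2 * ratioWronskian u y g m) →
          0 ≤ t * ratioWronskian u y g m := fun t m ht => by
        rw [mul_left_comm] at ht
        exact nonneg_of_mul_nonneg_right ht (div_pos (hS m) (pow_pos (hP m) 2))
      have hlim : Filter.Tendsto G Filter.atBot (nhds (w 0 * (h 1 - h 0))) := by
        have hhead : ∀ v : Fin (n + 2) → ℝ,
            Filter.Tendsto (expSum v z) Filter.atBot (nhds (v 0)) := fun v => by
          have := (tendsto_expSum_atBot (fun i => v i.succ) y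
            (fun i => .inl (hypos i))).const_add (v 0)
          rw [add_zero] at this
          refine this.congr fun m => ?_
          rw [expSum_succ v z]
          simp [hz0, hy]
        have := ((tendsto_expSum_ratio_atBot hupos hymono hgy).mul (hhead w)).sub (hhead (w * h))
        convert this using 2
        simp only [hg, Pi.mul_apply, Fin.succ_zero_eq_one]
        ring
      have hdiff : ∀ p q : ℝ, p < q → ∃ c ∈ Set.Ioo p q,
          G q - G p = (expSum w z c / expSum u y c ^ 2 * ratioWronskian u y g c) * (q - p) := by
        intro p q hpq
        obtain ⟨c, hc, hcs⟩ := exists_hasDerivAt_eq_slope G _ hpq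
          (fun m _ => (hGd m).continuousAt.continuousWithinAt) (fun m _ => hGd m)
        exact ⟨c, hc, by rw [hcs, div_mul_cancel₀ _ (sub_pos.mpr hpq).ne']⟩
      have hmean : ∀ t p q : ℝ, p < q → t * G p ≤ 0 → 0 ≤ t * G q →
          ∃ c ∈ Set.Ioo p q, 0 ≤ t * ratioWronskian u y g c := by
        intro t p q hpq hp hq
        obtain ⟨c, hc, hcs⟩ := hdiff p q hpq
        refine ⟨c, hc, hsgn t c (nonneg_of_mul_nonneg_left ?_ (sub_pos.mpr hpq))⟩
        rw [mul_assoc, ← hcs]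
        linarith
      have hξ : ∀ i : Fin r, ∃ c ∈ Set.Ioo (a i.castSucc) (a i.succ),
          0 ≤ -s * (-1) ^ (i : ℕ) * ratioWronskian u y g c := by
        intro i
        refine hmean _ _ _ (ha Fin.castSucc_lt_succ) ?_ ?_
        · have := hGs i.castSucc
          rw [Fin.val_castSucc] at this
          linarith
        · have := hGs i.succ
          rw [Fin.val_succ, pow_succ] at this
          linarith
      choose ξ hξ hξs using hξ
      have hξmono : StrictMono ξ := fun i j hij =>
        (hξ i).2.trans_le ((ha.monotone (Fin.succ_le_castSucc_iff.mpr hij)).trans (hξ j).1.le)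
      by_cases hne' : ∃ k : Fin n, g k.succ - g k.castSucc ≠ 0
      · by_cases h0 : 0 < s * (h 1 - h 0)
        · obtain ⟨b, hb, hbs⟩ := ih hupos hymono hgy hne' (neg_ne_zero.mpr hs) hξmono hξs
          exact hasAlternation_cons (Fin.strictMono_succ.comp hb) hbs (fun i => Fin.succ_pos _)
            (by simpa using h0)
        · have hfirst : ∃ c < a 0, 0 ≤ s * ratioWronskian u y g c := by
            by_contra! hcon
            have hdecr : ∀ p q : ℝ, p < q → q ≤ a 0 → s * G q < s * G p := by
              intro p q hpq hq
              obtain ⟨c, hc, hcs⟩ := hdiff p q hpq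
              by_contra! hle
              refine (hcon c (hc.2.trans_le hq)).not_ge
                (hsgn s c (nonneg_of_mul_nonneg_left ?_ (sub_pos.mpr hpq)))
              rw [mul_assoc, ← hcs]
              linarith
            have h1 : s * G (a 0 - 1) ≤ s * (w 0 * (h 1 - h 0)) :=
              ge_of_tendsto (hlim.const_mul s) ((Filter.eventually_lt_atBot (a 0 - 1)).mono
                fun m hm => (hdecr m _ hm (by linarith)).le)
            have h2 := hdecr (a 0 - 1) (a 0) (by linarith) le_rfl
            have h3 := hGs 0
            have h4 : s * (w 0 * (h 1 - h 0)) ≤ 0 := by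
              rw [mul_left_comm]
              exact mul_nonpos_of_nonneg_of_nonpos (hw 0).le (not_lt.mp h0)
            simp only [Fin.val_zero, pow_zero, mul_one] at h3
            linarith
          obtain ⟨c, hc, hcs⟩ := hfirst
          have := ih hupos hymono hgy hne' hs (a := Fin.cons c ξ)
            (strictMono_fin_cons hξmono fun i =>
              hc.trans_le ((ha.monotone (Fin.zero_le _)).trans (hξ i).1.le)) (fun i => by
              induction i using Fin.cases with
              | zero => simpa using hcs
              | succ i =>
                have := hξs i
                simp only [Fin.val_succ, Fin.cons_succ, pow_succ]
                linarith)
          exact HasAlternation.comp_strictMono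
            (f := fun k : Fin (n + 1) => h k.succ - h k.castSucc) Fin.strictMono_succ this
      · push Not at hne'
        have h0 : h 1 - h 0 ≠ 0 := by
          obtain ⟨k, hk⟩ := hne
          induction k using Fin.cases with
          | zero => simpa using hk
          | succ k => exact absurd (hne' k) (by simpa [hg] using hk)
        have hgc : ∀ i, g i = g 0 := fun i => by
          induction i using Fin.induction with
          | zero => rfl
          | succ i hi => rw [← hi]; exact sub_eq_zero.mp (hne' i)
        have hW0 : ∀ m, ratioWronskian u y g m = 0 := fun m => by
          have h1 : u * g = g 0 • u := by ext i; simp [hgc i, mul_comm]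
          have h2 : ∀ v : Fin (n + 1) → ℝ, expSum (g 0 • v) y m = g 0 * expSum v y m := fun v => by
            simp [expSum, Finset.mul_sum, mul_assoc]
          rw [ratioWronskian, h1, smul_mul_assoc, h2, h2]
          ring
        have hGc : ∀ m, G m = w 0 * (h 1 - h 0) := fun m => by
          refine tendsto_nhds_unique (tendsto_const_nhds.congr fun m' => ?_) hlim
          exact is_const_of_deriv_eq_zero (fun m => (hGd m).differentiableAt)
            (fun m => by rw [(hGd m).deriv, hW0, mul_zero]) m m'
        have hpos0 : 0 < s * (h 1 - h 0) := by
          have h1 := hGs 0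
          rw [hGc, Fin.val_zero, pow_zero, mul_one, mul_left_comm] at h1
          exact lt_of_le_of_ne (nonneg_of_mul_nonneg_right h1 (hw 0)) (mul_ne_zero hs h0).symm
        obtain _ | r := r
        · exact hasAlternation_cons (a := Fin.elim0) (p := 0) (fun i => i.elim0)
            (fun i => i.elim0) (fun i => i.elim0) (by simpa using hpos0)
        · have h1 := hGs 1
          rw [hGc, Fin.val_one, pow_one, mul_neg_one, mul_left_comm] at h1
          have := nonneg_of_mul_nonneg_right h1 (hw 0)
          linarith

/-- If each increment of `h` has the sign opposite to the Wronskian at the corresponding one of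
the increasing points `τ`, then `h` is constant. -/
theorem exists_pos_mul_ratioWronskian {n : ℕ} {w x h : Fin (n + 1) → ℝ} (hw : ∀ i, 0 < w i)
    (hx : Monotone x) (hh : ∀ i j, x i = x j → h i = h j)
    (hne : ∃ k : Fin n, h k.succ - h k.castSucc ≠ 0) {τ : Fin n → ℝ} (hτ : StrictMono τ) :
    ∃ k : Fin n, 0 < (h k.succ - h k.castSucc) * ratioWronskian w x h (τ k) := by
  by_contra! hcon
  set v : Fin n → ℝ := fun k => h k.succ - h k.castSucc
  have hbdd : ∀ {r s}, HasAlternation v r s → r ≤ n := fun hr => by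
    simpa using hr.le_card Finset.univ (by simp)
  have hex : ∃ r, 0 < r ∧ ∃ s : ℝ, s ≠ 0 ∧ HasAlternation v r s := by
    obtain ⟨k, hk⟩ := hne
    exact ⟨1, one_pos, v k, hk, hasAlternation_cons (a := Fin.elim0) (p := k) (fun i => i.elim0)
      (fun i => i.elim0) (fun i => i.elim0) (mul_self_pos.mpr hk)⟩
  obtain ⟨r, ⟨hr, s, hs, hrs⟩, hmax⟩ : ∃ r, (0 < r ∧ ∃ s : ℝ, s ≠ 0 ∧ HasAlternation v r s) ∧
      ∀ r', (0 < r' ∧ ∃ s : ℝ, s ≠ 0 ∧ HasAlternation v r' s) → r' ≤ r := by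
    classical
    obtain ⟨r, hr⟩ := hex
    exact ⟨_, Nat.findGreatest_spec (P := fun r => 0 < r ∧ ∃ s : ℝ, s ≠ 0 ∧ HasAlternation v r s)
      (hbdd hr.2.choose_spec.2) hr, fun r' hr' =>
      Nat.le_findGreatest (hbdd hr'.2.choose_spec.2) hr'⟩
  obtain ⟨a, ha, has⟩ := id hrs
  have hneg : HasAlternation v r (-s) := by
    refine hasAlternation_of_ratioWronskian hw hx hh hne (neg_ne_zero.mpr hs) (hτ.comp ha)
      fun i => ?_
    by_contra! hlt
    have h1 := mul_neg_of_pos_of_neg (has i) hlt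
    have h2 := hcon (a i)
    have h3 : 0 < (s * (-1) ^ (i : ℕ)) ^ 2 := by positivity
    simp only [Function.comp_apply] at h1
    nlinarith [mul_nonpos_of_nonneg_of_nonpos h3.le h2]
  rcases hrs.exists_succ hr hneg with h1 | h1
  · have := hmax _ ⟨r.succ_pos, s, hs, h1⟩
    omega
  · have := hmax _ ⟨r.succ_pos, -s, neg_ne_zero.mpr hs, h1⟩
    omega

open Matrix in
/-- The sign non-reversal property of `P`-matrices passes to the transpose. -/
theorem transpose_not_sign_reversing {ι : Type*} [Fintype ι] {A : Matrix ι ι ℝ}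
    (hA : ∀ v, v ≠ 0 → ∃ i, 0 < v i * (A *ᵥ v) i) {w : ι → ℝ} (hw : w ≠ 0) :
    ∃ i, 0 < w i * (Aᵀ *ᵥ w) i := by
  classical
  by_contra! hcon
  let S := {i // w i ≠ 0}
  let e : S → ℝ := fun i => -(Aᵀ *ᵥ w) i / w i
  have he : ∀ i, 0 ≤ e i := fun i => by
    have h1 := hcon i
    have h2 : e i = -(w i * (Aᵀ *ᵥ w) i) / (w i) ^ 2 := by
      have := i.2
      simp only [e]
      field_simp
    rw [h2]
    exact div_nonneg (neg_nonneg.mpr h1) (sq_nonneg _)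
  let B : Matrix S S ℝ := A.submatrix Subtype.val Subtype.val
  have hBw : (B + diagonal e)ᵀ *ᵥ (fun i : S => w i) = 0 := by
    ext i
    have hsum : (Bᵀ *ᵥ fun i : S => w i) i = (Aᵀ *ᵥ w) i := by
      simp only [mulVec, dotProduct]
      rw [← Finset.sum_filter_of_ne (p := fun j => w j ≠ 0) (s := Finset.univ)
        (f := fun j => Aᵀ i j * w j) (fun j _ h => right_ne_zero_of_mul h),
        Finset.sum_subtype (p := fun j => w j ≠ 0) _ (by simp)]
      rfl
    rw [transpose_add, add_mulVec, Pi.add_apply, hsum, diagonal_transpose, mulVec_diagonal]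
    have := i.2
    simp only [e, Pi.zero_apply]
    field_simp
    ring
  have hdet : (B + diagonal e).det = 0 := by
    rw [← det_transpose]
    refine exists_mulVec_eq_zero_iff.mp ⟨_, fun h => hw ?_, hBw⟩
    ext i
    by_contra hi
    exact hi (congrFun h ⟨i, hi⟩)
  obtain ⟨v, hv, hBv⟩ := exists_mulVec_eq_zero_iff.mpr hdet
  let v' : ι → ℝ := fun i => if h : w i ≠ 0 then v ⟨i, h⟩ else 0
  have hvv : ∀ i : S, v' i = v i := fun i => dif_pos i.2
  obtain ⟨i, hi⟩ := hA v' fun h => hv <| by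
    ext i
    rw [← hvv, h]
    rfl
  have hiw : w i ≠ 0 := by
    intro h
    simp [v', h] at hi
  have h1 : (A *ᵥ v') i = (B *ᵥ v) ⟨i, hiw⟩ := by
    simp only [mulVec, dotProduct]
    rw [← Finset.sum_filter_of_ne (p := fun j => w j ≠ 0) (s := Finset.univ)
      (f := fun j => A i j * v' j)
      (fun j _ h hj => h (by simp [v', hj])),
      Finset.sum_subtype (p := fun j => w j ≠ 0) _ (by simp)]
    exact Finset.sum_congr rfl fun j _ => by rw [hvv]; rfl
  have h2 := congrFun hBv ⟨i, hiw⟩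
  rw [add_mulVec, Pi.add_apply, mulVec_diagonal, Pi.zero_apply] at h2
  rw [h1, show v' i = v ⟨i, hiw⟩ from hvv ⟨i, hiw⟩, eq_neg_of_add_eq_zero_left h2] at hi
  nlinarith [mul_nonneg (he ⟨i, hiw⟩) (sq_nonneg (v ⟨i, hiw⟩))]

open Matrix in
/-- A `P`-matrix maps some strictly positive vector to a strictly positive vector. -/
theorem exists_pos_mulVec_pos {ι : Type*} [Fintype ι] {A : Matrix ι ι ℝ}
    (hA : ∀ v, v ≠ 0 → ∃ i, 0 < v i * (A *ᵥ v) i) :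
    ∃ t : ι → ℝ, (∀ i, 0 < t i) ∧ ∀ i, 0 < (A *ᵥ t) i := by
  classical
  by_contra! hcon
  let C : Set (ι → ℝ) := Set.pi Set.univ fun _ => Set.Ioi 0
  have hC : Convex ℝ C := convex_pi fun _ _ => convex_Ioi 0
  have hCo : IsOpen C := isOpen_set_pi Set.finite_univ fun _ _ => isOpen_Ioi
  have hdisj : Disjoint C (A.mulVecLin '' C) := by
    rw [Set.disjoint_left]
    rintro _ hy ⟨t, ht, rfl⟩
    obtain ⟨i, hi⟩ := hcon t fun i => ht i (Set.mem_univ i)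
    exact hi.not_gt (hy i (Set.mem_univ i))
  obtain ⟨f, c, hfC, hfA⟩ := geometric_hahn_banach_open hC hCo (hC.linear_image _) hdisj
  have hclos : ∀ (g : (ι → ℝ) →ₗ[ℝ] ℝ) (c : ℝ), (∀ t ∈ C, c ≤ g t) →
      ∀ t : ι → ℝ, (∀ i, 0 ≤ t i) → 0 ≤ g t := by
    intro g c hg t ht
    by_contra! hneg
    have h1 : ∀ k : ℝ, 0 ≤ k → c ≤ g 1 + k * g t := fun k hk => by
      have := hg (1 + k • t) fun i _ => by
        have := mul_nonneg hk (ht i)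
        simp only [Pi.add_apply, Pi.one_apply, Pi.smul_apply, smul_eq_mul, Set.mem_Ioi]
        linarith
      simpa using this
    have h2 := h1 0 le_rfl
    have h3 := h1 ((c - g 1 - 1) / g t) (div_nonneg_of_nonpos (by linarith) hneg.le)
    rw [div_mul_cancel₀ _ hneg.ne] at h3
    linarith
  set w : ι → ℝ := fun i => -f (Pi.single i 1) with hw
  have hfw : ∀ t : ι → ℝ, f t = -(w ⬝ᵥ t) := fun t => by
    conv_lhs => rw [← Finset.univ_sum_single t]
    rw [map_sum, dotProduct, ← Finset.sum_neg_distrib]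
    refine Finset.sum_congr rfl fun i _ => ?_
    rw [show Pi.single i (t i) = t i • (Pi.single i 1 : ι → ℝ) by
      rw [← Pi.single_smul, smul_eq_mul, mul_one], map_smul, hw, smul_eq_mul]
    ring
  have hw0 : ∀ i, 0 ≤ w i := fun i => by
    have := hclos (-f.toLinearMap) (-c) (fun t ht => by simpa using (hfC t ht).le)
      (Pi.single i 1) (fun j => by
        rcases eq_or_ne j i with rfl | h
        · simp
        · simp [h])
    simpa [hw] using this
  have hne : w ≠ 0 := by
    intro h
    have h1 := hfC 1 fun i _ => by simp
    have h2 := hfA _ (Set.mem_image_of_mem A.mulVecLin (x := 1) fun i _ => by simp)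
    rw [hfw, h] at h1 h2
    simp at h1 h2
    linarith
  obtain ⟨i, hi⟩ := transpose_not_sign_reversing hA hne
  have := hclos (f.toLinearMap.comp A.mulVecLin) c
    (fun t ht => hfA _ (Set.mem_image_of_mem _ ht)) (Pi.single i 1) (fun j => by
        rcases eq_or_ne j i with rfl | h
        · simp
        · simp [h])
  simp only [LinearMap.coe_comp, Function.comp_apply, mulVecLin_apply,
    ContinuousLinearMap.coe_coe] at this
  rw [hfw, dotProduct_mulVec, dotProduct_single, mul_one, ← mulVec_transpose] at this
  exact (mul_nonpos_of_nonneg_of_nonpos (hw0 i) (by linarith)).not_gt hi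

/-- A map whose derivative is sign non-reversing at `a` is so between `a` and nearby points. -/
theorem eventually_exists_pos_mul_sub {ι : Type*} [Fintype ι] {F : (ι → ℝ) → ι → ℝ}
    {L : ι → (ι → ℝ) →L[ℝ] ℝ} {a : ι → ℝ}
    (hF : ∀ i, HasFDerivAt (fun z => F z i) (L i) a)
    (hP : ∀ v, v ≠ 0 → ∃ i, 0 < v i * L i v) :
    ∀ᶠ z in nhds a, z ≠ a → ∃ i, 0 < (z i - a i) * (F z i - F a i) := by
  let φ : (ι → ℝ) → ℝ := fun v => ∑ i, max 0 (v i * L i v)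
  have hφc : Continuous φ := by fun_prop
  have hφpos : ∀ v, v ≠ 0 → 0 < φ v := fun v hv => by
    obtain ⟨i, hi⟩ := hP v hv
    exact Finset.sum_pos' (fun i _ => le_max_left _ _)
      ⟨i, Finset.mem_univ i, lt_max_of_lt_right hi⟩
  obtain ⟨δ, hδ, hδφ⟩ : ∃ δ > 0, ∀ v ∈ Metric.sphere (0 : ι → ℝ) 1, δ ≤ φ v :=
    (isCompact_sphere _ _).exists_forall_le' hφc.continuousOn
      (fun v hv => hφpos v (Metric.ne_of_mem_sphere hv one_ne_zero))
  have hhom : ∀ v, δ * ‖v‖ ^ 2 ≤ φ v := fun v => by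
    rcases eq_or_ne v 0 with rfl | hv
    · simpa using Finset.sum_nonneg fun i _ => le_max_left _ _
    have hn := norm_pos_iff.mpr hv
    have h1 := hδφ (‖v‖⁻¹ • v) (by simp [norm_smul, hn.ne'])
    have h2 : φ (‖v‖⁻¹ • v) = (‖v‖⁻¹) ^ 2 * φ v := by
      simp only [φ, Finset.mul_sum]
      refine Finset.sum_congr rfl fun i _ => ?_
      rw [mul_max_of_nonneg _ _ (sq_nonneg _)]
      simp only [Pi.smul_apply, smul_eq_mul, map_smul, mul_zero]
      congr 1
      ring
    rw [h2, inv_pow, ← div_eq_inv_mul, le_div_iff₀ (by positivity)] at h1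
    exact h1
  obtain ⟨ε, hε, hεδ⟩ : ∃ ε > 0, (Fintype.card ι : ℝ) * ε < δ :=
    ⟨δ / (Fintype.card ι + 1), by positivity, by
      rw [mul_div_assoc', div_lt_iff₀ (by positivity)]; nlinarith⟩
  have hsmall : ∀ᶠ z in nhds a, ∀ i, ‖F z i - F a i - L i (z - a)‖ ≤ ε * ‖z - a‖ :=
    Filter.eventually_all.mpr fun i => (hF i).isLittleO.def hε
  filter_upwards [hsmall] with z hz hza
  by_contra! hcon
  have h1 : φ (z - a) ≤ ∑ i : ι, ε * ‖z - a‖ ^ 2 := by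
    refine Finset.sum_le_sum fun i _ => max_le (by positivity) ?_
    have h2 : (z - a) i * L i (z - a) ≤ (z - a) i * (L i (z - a) - (F z i - F a i)) := by
      have := hcon i
      rw [Pi.sub_apply]
      linarith
    refine h2.trans ((le_abs_self _).trans ?_)
    rw [abs_mul, abs_sub_comm, sq, ← mul_assoc, mul_comm ε, mul_assoc]
    exact mul_le_mul (norm_le_pi_norm (z - a) i) (hz i) (abs_nonneg _) (norm_nonneg _)
  rw [Finset.sum_const, nsmul_eq_mul, Finset.card_univ, ← mul_assoc] at h1
  have h3 : 0 < ‖z - a‖ ^ 2 := by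
    have := norm_pos_iff.mpr (sub_ne_zero.mpr hza)
    positivity
  nlinarith [hhom (z - a)]

open Matrix in
/-- Gale–Nikaido: a map whose derivative is sign non-reversing on the box spanned by `a` and `b`
does not reverse the sign of `b - a`. -/
theorem exists_pos_mul_sub_of_hasFDerivAt {ι : Type*} [Fintype ι] {F : (ι → ℝ) → ι → ℝ}
    {L : (ι → ℝ) → ι → (ι → ℝ) →L[ℝ] ℝ} {a b : ι → ℝ}
    (hF : ∀ z ∈ Set.uIcc a b, ∀ i, HasFDerivAt (fun z => F z i) (L z i) z)
    (hP : ∀ z ∈ Set.uIcc a b, ∀ v, v ≠ 0 → ∃ i, 0 < v i * L z i v) (hab : b ≠ a) :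
    ∃ i, 0 < (b i - a i) * (F b i - F a i) := by
  classical
  by_contra! hcon
  obtain ⟨ρ, hρ, hρa⟩ := Metric.eventually_nhds_iff.mp (eventually_exists_pos_mul_sub
    (hF a Set.left_mem_uIcc) (hP a Set.left_mem_uIcc))
  let Z : Set (ι → ℝ) :=
    {z ∈ Set.uIcc a b | ρ ≤ dist z a ∧ ∀ i, (z i - a i) * (F z i - F a i) ≤ 0}
  have hFc : ContinuousOn F (Set.uIcc a b) := fun z hz =>
    (continuousAt_pi.mpr fun i => (hF z hz i).continuousAt).continuousWithinAt
  have hZ : ∀ z ∈ Set.uIcc a b, z ≠ a → (∀ i, (z i - a i) * (F z i - F a i) ≤ 0) → z ∈ Z := by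
    refine fun z hz hza hzF => ⟨hz, ?_, hzF⟩
    by_contra! hlt
    obtain ⟨i, hi⟩ := hρa hlt hza
    exact (hzF i).not_gt hi
  have hZcomp : IsCompact Z := by
    have hK : IsCompact (Set.uIcc a b) := isCompact_Icc
    refine hK.of_isClosed_subset ?_ fun z hz => hz.1
    have h1 : IsClosed (Set.uIcc a b ∩
        (fun z : ι → ℝ => ∑ i, max 0 ((z i - a i) * (F z i - F a i))) ⁻¹' Set.Iic 0) :=
      ContinuousOn.preimage_isClosed_of_isClosed (by fun_prop) hK.isClosed isClosed_Iic
    have h2 : IsClosed {z : ι → ℝ | ρ ≤ dist z a} :=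
      isClosed_le continuous_const (continuous_id.dist continuous_const)
    convert h1.inter h2 using 1
    ext z
    constructor
    · rintro ⟨h1, h2, h3⟩
      exact ⟨⟨h1, (Finset.sum_eq_zero fun i _ => max_eq_left (h3 i)).le⟩, h2⟩
    · rintro ⟨⟨h1, h2⟩, h3⟩
      refine ⟨h1, h3, fun i => ?_⟩
      exact (le_max_right _ _).trans ((Finset.single_le_sum
        (f := fun i => max 0 ((z i - a i) * (F z i - F a i))) (fun i _ => le_max_left _ _)
        (Finset.mem_univ i)).trans h2)
  obtain ⟨z, ⟨hz, hza, hzF⟩, hzmin⟩ := hZcomp.exists_isMinOn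
    ⟨b, hZ b Set.right_mem_uIcc hab hcon⟩
    (f := fun z => ∑ i, |z i - a i|) (by fun_prop)
  let S := {i // z i - a i ≠ 0}
  have hzne : z ≠ a := fun h => by
    rw [h, dist_self] at hza
    exact hza.not_gt hρ
  have hS : ∃ i, z i - a i ≠ 0 := by
    by_contra! h
    exact hzne (funext fun i => sub_eq_zero.mp (h i))
  let E : (S → ℝ) →ₗ[ℝ] (ι → ℝ) :=
    { toFun := fun t i => if h : z i - a i ≠ 0 then (z i - a i) * t ⟨i, h⟩ else 0
      map_add' := fun t t' => by
        ext i
        by_cases h : z i - a i = 0 <;> simp [h, mul_add]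
      map_smul' := fun c t => by
        ext i
        by_cases h : z i - a i = 0 <;> simp [h, mul_left_comm] }
  have hE : ∀ t (i : S), E t i = (z i - a i) * t i := fun t i => dif_pos i.2
  have hE0 : ∀ t i, z i - a i = 0 → E t i = 0 := fun t i h => dif_neg (not_not.mpr h)
  let A : Matrix S S ℝ := LinearMap.toMatrix' (LinearMap.pi fun i : S =>
    (z i - a i) • ((L z i).toLinearMap.comp E))
  have hAt : ∀ t i, (A *ᵥ t) i = (z i - a i) * L z i (E t) := fun t i => by
    rw [← Matrix.toLin'_apply, Matrix.toLin'_toMatrix']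
    simp
  obtain ⟨t, ht, hAtpos⟩ := exists_pos_mulVec_pos (A := A) fun t ht => by
    have hEt : E t ≠ 0 := fun h => ht <| by
      ext i
      have := congrFun h i
      rw [hE, Pi.zero_apply] at this
      exact (mul_eq_zero.mp this).resolve_left i.2
    obtain ⟨i, hi⟩ := hP z hz _ hEt
    have hiS : z i - a i ≠ 0 := fun h => by simp [hE0 t i h] at hi
    refine ⟨⟨i, hiS⟩, ?_⟩
    rw [hAt]
    rw [hE t ⟨i, hiS⟩] at hi
    linarith
  have hmove : ∀ᶠ ε in nhdsWithin (0 : ℝ) (Set.Ioi 0), ∀ i : S,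
      ε * t i < 1 ∧ (z i - a i) * (F (z - ε • E t) i - F z i) < 0 := by
    refine Filter.eventually_all.mpr fun i => Filter.Eventually.and ?_ ?_
    · have : Filter.Tendsto (fun ε : ℝ => ε * t i) (nhds 0) (nhds (0 * t i)) :=
        (continuous_mul_const (t i)).tendsto 0
      rw [zero_mul] at this
      exact (this.eventually_lt_const one_pos).filter_mono nhdsWithin_le_nhds
    · have hline : HasDerivAt (fun ε : ℝ => (z i - a i) * F (z - ε • E t) i)
          (-((z i - a i) * L z i (E t))) 0 := by
        have h1 : HasDerivAt (fun ε : ℝ => z - ε • E t) (-E t) 0 := by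
          simpa using ((hasDerivAt_id (0 : ℝ)).smul_const (E t)).const_sub z
        have h2 : HasFDerivAt (fun z => F z i) (L z i) (z - (0 : ℝ) • E t) := by
          simpa using hF z hz i
        have h3 := (h2.comp_hasDerivAt (0 : ℝ) h1).const_mul (z i - a i)
        simpa using h3
      have hneg : -((z i - a i) * L z i (E t)) < 0 := by
        have := hAtpos i
        rw [hAt] at this
        linarith
      have h4 := (hasDerivWithinAt_iff_tendsto_slope' (s := Set.Ioi (0 : ℝ)) (by simp)).mp
        hline.hasDerivWithinAt
      filter_upwards [h4.eventually_lt_const hneg, self_mem_nhdsWithin] with ε hε hε0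
      rw [slope_def_field, zero_smul, sub_zero, sub_zero, div_lt_iff₀ hε0, zero_mul] at hε
      linarith
  obtain ⟨ε, hε, hε0⟩ := (hmove.and self_mem_nhdsWithin).exists
  have hcoord : ∀ i : S, (z - ε • E t) i - a i = (z i - a i) * (1 - ε * t i) := fun i => by
    simp only [Pi.sub_apply, Pi.smul_apply, smul_eq_mul, hE]
    ring
  have hcoord0 : ∀ i, z i - a i = 0 → (z - ε • E t) i = a i := fun i hi => by
    simp only [Pi.sub_apply, Pi.smul_apply, smul_eq_mul, hE0 t i hi]
    linarith
  have hlt : ∀ i : S, 0 < ε * t i ∧ ε * t i < 1 := fun i => ⟨mul_pos hε0 (ht i), (hε i).1⟩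
  have hnew : z - ε • E t ∈ Z := by
    refine hZ _ ?_ ?_ ?_
    · rw [Set.uIcc, Set.mem_Icc, Pi.le_def, Pi.le_def] at hz ⊢
      have hkey : ∀ i, (z - ε • E t) i ∈ Set.uIcc (a i) (z i) := fun i => by
        by_cases hi : z i - a i ≠ 0
        · have h1 := hcoord ⟨i, hi⟩
          obtain ⟨h2, h3⟩ := hlt ⟨i, hi⟩
          rw [Set.mem_uIcc]
          simp only at h1
          rcases lt_or_gt_of_ne hi with h | h
          · right; constructor <;> nlinarith
          · left; constructor <;> nlinarith
        · rw [hcoord0 i (not_not.mp hi)]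
          exact Set.left_mem_uIcc
      have hsub : ∀ i, (z - ε • E t) i ∈ Set.uIcc (a i) (b i) := fun i =>
        Set.uIcc_subset_uIcc_left (by exact ⟨hz.1 i, hz.2 i⟩) (hkey i)
      exact ⟨fun i => (hsub i).1, fun i => (hsub i).2⟩
    · obtain ⟨i, hi⟩ := hS
      intro h
      have h1 := hcoord ⟨i, hi⟩
      rw [h, sub_self] at h1
      have h2 := (hlt ⟨i, hi⟩).2
      exact (mul_ne_zero hi (by linarith)) h1.symm
    · intro i
      by_cases hi : z i - a i ≠ 0
      · rw [hcoord ⟨i, hi⟩]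
        have h1 := hzF i
        have h2 := (hε ⟨i, hi⟩).2
        have h3 := (hlt ⟨i, hi⟩).2
        simp only at h2
        have h4 : (z i - a i) * (F (z - ε • E t) i - F a i) ≤ 0 := by linarith
        have h5 : 0 ≤ 1 - ε * t ⟨i, hi⟩ := by linarith
        simp only
        nlinarith [mul_nonpos_of_nonneg_of_nonpos h5 h4]
      · rw [hcoord0 i (not_not.mp hi), sub_self, zero_mul]
  have hle : ∑ i, |z i - a i| ≤ ∑ i, |(z - ε • E t) i - a i| := hzmin hnew
  refine hle.not_gt (Finset.sum_lt_sum (fun i _ => ?_) ?_)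
  · by_cases hi : z i - a i ≠ 0
    · rw [hcoord ⟨i, hi⟩, abs_mul]
      obtain ⟨h2, h3⟩ := hlt ⟨i, hi⟩
      exact mul_le_of_le_one_right (abs_nonneg _) (abs_le.mpr ⟨by linarith, by linarith⟩)
    · rw [hcoord0 i (not_not.mp hi), sub_self, abs_zero]
      exact abs_nonneg _
  · obtain ⟨i, hi⟩ := hS
    refine ⟨i, Finset.mem_univ i, ?_⟩
    rw [hcoord ⟨i, hi⟩, abs_mul]
    obtain ⟨h2, h3⟩ := hlt ⟨i, hi⟩
    exact mul_lt_of_lt_one_right (abs_pos.mpr hi) (abs_lt.mpr ⟨by linarith, by linarith⟩)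

/-- The partial sums of a sequence of gaps. -/
noncomputable def gapSum {n : ℕ} : (Fin n → ℝ) →L[ℝ] (Fin (n + 1) → ℝ) :=
  ContinuousLinearMap.pi fun i => ∑ k with k.castSucc < i, ContinuousLinearMap.proj k

theorem gapSum_apply {n : ℕ} (a : Fin n → ℝ) (i : Fin (n + 1)) :
    gapSum a i = ∑ k with k.castSucc < i, a k := by
  simp [gapSum]

theorem gapSum_succ_sub_castSucc {n : ℕ} (a : Fin n → ℝ) (k : Fin n) :
    gapSum a k.succ - gapSum a k.castSucc = a k := by
  have : (Finset.univ.filter fun l : Fin n => l.castSucc < k.succ) =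
      insert k (Finset.univ.filter fun l : Fin n => l.castSucc < k.castSucc) := by
    ext l
    rw [Finset.mem_insert, Finset.mem_filter_univ, Finset.mem_filter_univ, Fin.castSucc_lt_succ_iff,
      Fin.castSucc_lt_castSucc_iff, le_iff_eq_or_lt]
  rw [gapSum_apply, gapSum_apply, this, Finset.sum_insert (by simp)]
  ring

theorem gapSum_monotone {n : ℕ} {a : Fin n → ℝ} (ha : ∀ k, 0 ≤ a k) : Monotone (gapSum a) :=
  Fin.monotone_iff_le_succ.mpr fun k => sub_nonneg.mp ((gapSum_succ_sub_castSucc a k).symm ▸ ha k)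

theorem gapSum_eq_of_gapSum_eq {n : ℕ} {a v : Fin n → ℝ} (ha : ∀ k, 0 ≤ a k)
    (hv : ∀ k, a k = 0 → v k = 0) {i j : Fin (n + 1)} (hij : gapSum a i = gapSum a j) :
    gapSum v i = gapSum v j := by
  wlog hle : i ≤ j generalizing i j
  · exact (this hij.symm (le_of_not_ge hle)).symm
  have hsub : (Finset.univ.filter fun k : Fin n => k.castSucc < i) ⊆
      Finset.univ.filter fun k : Fin n => k.castSucc < j :=
    Finset.monotone_filter_right _ fun k _ hk => hk.trans_le hle
  simp only [gapSum_apply] at hij ⊢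
  rw [← Finset.sum_sdiff hsub, right_eq_add, Finset.sum_eq_zero_iff_of_nonneg
    fun k _ => ha k] at hij
  rw [← Finset.sum_sdiff hsub, right_eq_add]
  exact Finset.sum_eq_zero fun k hk => hv k (hij k hk)

/-- The negative of the generalized Shannon entropy of order `m`, as a function of the logarithms
of the (not necessarily normalized) probabilities. -/
noncomputable def negEntropy {n : ℕ} (m : ℝ) (x : Fin n → ℝ) : ℝ :=
  m * expSum x x m / expSum 1 x m - Real.log (expSum 1 x m)

theorem expSum_one_pos {n : ℕ} (x : Fin (n + 1) → ℝ) (m : ℝ) : 0 < expSum 1 x m :=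
  expSum_pos (fun _ => one_pos) x m

theorem differentiable_negEntropy {n : ℕ} (m : ℝ) :
    Differentiable ℝ (negEntropy m : (Fin (n + 1) → ℝ) → ℝ) := by
  intro x
  have hpos := (expSum_one_pos x m).ne'
  unfold negEntropy
  have h1 : DifferentiableAt ℝ (fun x : Fin (n + 1) → ℝ => expSum x x m) x := by
    unfold expSum; fun_prop
  have h2 : DifferentiableAt ℝ (fun x : Fin (n + 1) → ℝ => expSum 1 x m) x := by
    unfold expSum; fun_prop
  fun_prop (disch := assumption)

theorem hasDerivAt_negEntropy_line {n : ℕ} (m : ℝ) (x h : Fin (n + 1) → ℝ) :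
    HasDerivAt (fun t : ℝ => negEntropy m (x + t • h))
      (m ^ 2 * ratioWronskian 1 x h m / expSum 1 x m ^ 2) 0 := by
  have hx : ∀ i, HasDerivAt (fun t : ℝ => (x + t • h) i) (h i) 0 := fun i => by
    simpa using ((hasDerivAt_id (0 : ℝ)).mul_const (h i)).const_add (x i)
  have he : ∀ i, HasDerivAt (fun t : ℝ => Real.exp (m * (x + t • h) i))
      (Real.exp (m * x i) * (m * h i)) 0 := fun i => by
    simpa using ((hx i).const_mul m).exp
  have hN : HasDerivAt (fun t : ℝ => expSum (x + t • h) (x + t • h) m)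
      (expSum h x m + m * expSum (h * x) x m) 0 := by
    refine (HasDerivAt.fun_sum fun i _ => (hx i).mul (he i)).congr_deriv ?_
    simp only [expSum, Finset.mul_sum, ← Finset.sum_add_distrib, Pi.mul_apply]
    refine Finset.sum_congr rfl fun i _ => ?_
    simp only [zero_smul, add_zero]
    ring
  have hS : HasDerivAt (fun t : ℝ => expSum 1 (x + t • h) m) (m * expSum h x m) 0 := by
    refine (HasDerivAt.fun_sum fun i _ => (he i).const_mul ((1 : Fin (n + 1) → ℝ) i)).congr_deriv ?_
    simp only [expSum, Finset.mul_sum]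
    refine Finset.sum_congr rfl fun i _ => ?_
    simp only [Pi.one_apply]
    ring
  have hpos := (expSum_one_pos x m).ne'
  have hpos' : expSum 1 (x + (0 : ℝ) • h) m ≠ 0 := by simpa using hpos
  refine (((hN.const_mul m).div hS hpos').sub (hS.log hpos')).congr_deriv ?_
  simp only [zero_smul, add_zero, ratioWronskian, one_mul]
  field_simp
  ring

theorem fderiv_negEntropy {n : ℕ} (m : ℝ) (x h : Fin (n + 1) → ℝ) :
    fderiv ℝ (negEntropy m) x h = m ^ 2 * ratioWronskian 1 x h m / expSum 1 x m ^ 2 := by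
  refine HasDerivAt.unique ?_ (hasDerivAt_negEntropy_line m x h)
  have h1 : HasDerivAt (fun t : ℝ => x + t • h) h 0 := by
    simpa using ((hasDerivAt_id (0 : ℝ)).smul_const h).const_add x
  exact HasFDerivAt.comp_hasDerivAt (0 : ℝ) (by simpa using
    (differentiable_negEntropy m x).hasFDerivAt) h1

/-- The negative of the entropy of order `exp τ`, as a function of the gaps between consecutive
logarithms of the probabilities. -/
noncomputable def gapEntropy {n : ℕ} (a : Fin n → ℝ) (τ : ℝ) : ℝ :=
  negEntropy (Real.exp τ) (gapSum a)

theorem hasFDerivAt_gapEntropy {n : ℕ} (a : Fin n → ℝ) (τ : ℝ) :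
    HasFDerivAt (fun a : Fin n → ℝ => gapEntropy a τ)
      ((fderiv ℝ (negEntropy (Real.exp τ)) (gapSum a)).comp gapSum) a :=
  (differentiable_negEntropy _ _).hasFDerivAt.comp a gapSum.hasFDerivAt

theorem continuous_gapEntropy_left {n : ℕ} (τ : ℝ) :
    Continuous fun a : Fin n → ℝ => gapEntropy a τ :=
  continuous_iff_continuousAt.mpr fun a => (hasFDerivAt_gapEntropy a τ).continuousAt

theorem analyticOnNhd_gapEntropy {n : ℕ} (a : Fin n → ℝ) :
    AnalyticOnNhd ℝ (gapEntropy a) Set.univ := by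
  intro τ _
  have h : ∀ w : Fin (n + 1) → ℝ, AnalyticAt ℝ (fun t => expSum w (gapSum a) (Real.exp t)) τ :=
    fun w => by
      unfold expSum
      fun_prop
  have hpos := expSum_one_pos (gapSum a) (Real.exp τ)
  have h1 : AnalyticAt ℝ (fun t => Real.exp t) τ := by fun_prop
  exact ((h1.mul (h _)).div (h 1) hpos.ne').sub ((h 1).log hpos)

theorem continuous_gapEntropy {n : ℕ} (a : Fin n → ℝ) : Continuous (gapEntropy a) :=
  continuous_iff_continuousAt.mpr fun τ => (analyticOnNhd_gapEntropy a τ trivial).continuousAt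

theorem exists_pos_mul_gapEntropy_sub {n : ℕ} {a b : Fin n → ℝ} (ha : ∀ k, 0 < a k)
    (hb : ∀ k, 0 < b k) (hab : b ≠ a) {τ : Fin n → ℝ} (hτ : StrictMono τ) :
    ∃ i, 0 < (b i - a i) * (gapEntropy b (τ i) - gapEntropy a (τ i)) := by
  refine exists_pos_mul_sub_of_hasFDerivAt (F := fun z i => gapEntropy z (τ i))
    (fun z _ i => hasFDerivAt_gapEntropy z (τ i)) (fun z hz v hv => ?_) hab
  have hz0 : ∀ k, 0 < z k := fun k => (lt_min (ha k) (hb k)).trans_le (hz.1 k)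
  obtain ⟨k, hk⟩ := exists_pos_mul_ratioWronskian (w := 1) (x := gapSum z) (h := gapSum v)
    (fun _ => one_pos) (gapSum_monotone fun k => (hz0 k).le)
    (fun i j => gapSum_eq_of_gapSum_eq (fun k => (hz0 k).le) fun k hk => absurd hk (hz0 k).ne')
    (by simpa [gapSum_succ_sub_castSucc, ← Function.ne_iff] using Function.ne_iff.mp hv)
    (Real.exp_strictMono.comp hτ)
  rw [gapSum_succ_sub_castSucc] at hk
  refine ⟨k, ?_⟩
  rw [ContinuousLinearMap.comp_apply, fderiv_negEntropy, mul_div_assoc', mul_left_comm]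
  exact div_pos (mul_pos (pow_pos (Real.exp_pos _) 2) hk) (pow_pos (expSum_one_pos _ _) 2)

theorem exists_nonneg_mul_gapEntropy_sub {n : ℕ} {a b : Fin n → ℝ} (ha : ∀ k, 0 ≤ a k)
    (hb : ∀ k, 0 ≤ b k) (hab : b ≠ a) {τ : Fin n → ℝ} (hτ : StrictMono τ) :
    ∃ i, b i ≠ a i ∧ 0 ≤ (b i - a i) * (gapEntropy b (τ i) - gapEntropy a (τ i)) := by
  by_contra! hcon
  let sh : (Fin n → ℝ) → ℝ → Fin n → ℝ := fun a ε => a + ε • 1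
  have hlim : ∀ (a : Fin n → ℝ) (t : ℝ),
      Filter.Tendsto (fun ε => gapEntropy (sh a ε) t) (nhds 0) (nhds (gapEntropy a t)) :=
    fun a t => by
      have h1 : Continuous fun ε => gapEntropy (sh a ε) t :=
        (continuous_gapEntropy_left t).comp (by fun_prop)
      simpa [sh] using h1.tendsto 0
  have hev : ∀ᶠ ε in nhdsWithin (0 : ℝ) (Set.Ioi 0), ∀ i, b i ≠ a i →
      (b i - a i) * (gapEntropy (sh b ε) (τ i) - gapEntropy (sh a ε) (τ i)) < 0 := by
    refine Filter.eventually_all.mpr fun i => ?_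
    by_cases hi : b i = a i
    · simp [hi]
    refine ((((hlim b (τ i)).sub (hlim a (τ i))).const_mul (b i - a i)).eventually_lt_const
      (hcon i hi)).filter_mono nhdsWithin_le_nhds |>.mono fun ε hε _ => hε
  obtain ⟨ε, hε, hε0⟩ := (hev.and self_mem_nhdsWithin).exists
  obtain ⟨i, hi⟩ := exists_pos_mul_gapEntropy_sub (a := sh a ε) (b := sh b ε)
    (fun k => by simpa [sh] using add_pos_of_nonneg_of_pos (ha k) hε0)
    (fun k => by simpa [sh] using add_pos_of_nonneg_of_pos (hb k) hε0)
    (fun h => hab (add_right_cancel h)) hτ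
  have hsub : sh b ε i - sh a ε i = b i - a i := by simp [sh]
  rw [hsub] at hi
  refine (hε i fun h => ?_).not_gt hi
  simp [h] at hi

/-- Descartes' rule of signs for the difference of two entropies. -/
theorem hasAlternation_sub_of_gapEntropy {n : ℕ} {a b : Fin n → ℝ} (ha : ∀ k, 0 ≤ a k)
    (hb : ∀ k, 0 ≤ b k) {r : ℕ} {s : ℝ}
    (h : HasAlternation (fun τ => gapEntropy b τ - gapEntropy a τ) r s) :
    HasAlternation (b - a) r s := by
  rcases eq_or_ne b a with rfl | hab
  · obtain _ | r := r
    · exact hasAlternation_zero _ _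
    · obtain ⟨P, -, hs⟩ := h
      simpa using hs 0
  by_contra hcon
  obtain ⟨P, hP, hPs⟩ := h
  obtain ⟨j, hj, hjs⟩ := exists_monotone_of_not_hasAlternation _ hcon
  have hev : ∀ᶠ δ in nhdsWithin (0 : ℝ) (Set.Ioi 0), ∀ i : Fin n,
      0 < s * (-1) ^ (j i : ℕ) * (gapEntropy b (P (j i) + δ * (i : ℕ)) -
        gapEntropy a (P (j i) + δ * (i : ℕ))) := by
    refine Filter.eventually_all.mpr fun i => ?_
    have hc : Continuous fun δ : ℝ => s * (-1) ^ (j i : ℕ) *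
        (gapEntropy b (P (j i) + δ * (i : ℕ)) - gapEntropy a (P (j i) + δ * (i : ℕ))) := by
      have := continuous_gapEntropy a
      have := continuous_gapEntropy b
      fun_prop
    exact ((hc.tendsto 0).eventually_const_lt (by simpa using hPs (j i))).filter_mono
      nhdsWithin_le_nhds
  obtain ⟨δ, hδ, hδ0⟩ := (hev.and self_mem_nhdsWithin).exists
  obtain ⟨i, hne, hi⟩ := exists_nonneg_mul_gapEntropy_sub ha hb hab
    (τ := fun i => P (j i) + δ * (i : ℕ)) fun i k hik => by
      have h1 := hP.monotone (hj hik.le)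
      have h2 : ((i : ℕ) : ℝ) < (k : ℕ) := by exact_mod_cast hik
      have := mul_lt_mul_of_pos_left h2 hδ0
      simp only
      linarith
  have h1 := hδ i
  have h2 := hjs i
  rw [Pi.sub_apply] at h2
  have h3 : s * (-1) ^ (j i : ℕ) ≠ 0 := left_ne_zero_of_mul h1.ne'
  have h4 := lt_of_le_of_ne h2 (mul_ne_zero h3 (sub_ne_zero.mpr hne))
  have h5 := mul_neg_of_neg_of_pos h4 h1
  nlinarith [mul_nonneg (sq_nonneg (s * (-1) ^ (j i : ℕ))) hi]

/-- A function with prescribed signs at points interlacing `τ`, and at some of the `τ i`,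
alternates as often as these signs force it to. -/
theorem exists_alternation_of_interlacing {f : ℝ → ℝ} {n : ℕ} {q : Fin (n + 1) → ℝ}
    {τ : Fin n → ℝ} (hτ : ∀ i, q i.castSucc < τ i ∧ τ i < q i.succ) (hq : ∀ j, f (q j) ≠ 0)
    (c : Fin n → ℕ) (hc : ∀ i, c i = 0 ∧ 0 < f (q i.castSucc) * f (q i.succ) ∨
      c i = 1 ∧ f (q i.castSucc) * f (q i.succ) < 0 ∨
      c i = 2 ∧ 0 < f (q i.castSucc) * f (q i.succ) ∧ f (q i.castSucc) * f (τ i) < 0) :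
    ∃ (L : ℕ) (a : Fin L → ℝ), L = 1 + ∑ i, c i ∧ StrictMono a ∧ (∀ i, q 0 ≤ a i) ∧
      ∀ i : Fin L, 0 < f (q 0) * (-1) ^ (i : ℕ) * f (a i) := by
  induction n with
  | zero =>
    refine ⟨1, fun _ => q 0, by simp, Subsingleton.strictMono _, fun _ => le_rfl, fun i => ?_⟩
    simpa using mul_self_pos.mpr (hq 0)
  | succ n ih =>
    have hcons : ∀ {L : ℕ} {a : Fin L → ℝ} {p u v : ℝ}, StrictMono a → (∀ i, p < a i) →
        (∀ i : Fin L, 0 < v * (-1) ^ (i : ℕ) * f (a i)) → u * v < 0 → 0 < u * f p →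
        StrictMono (Fin.cons p a : Fin (L + 1) → ℝ) ∧ ∀ i : Fin (L + 1),
          0 < u * (-1) ^ (i : ℕ) * f ((Fin.cons p a : Fin (L + 1) → ℝ) i) := by
      intro L a p u v ha hp hs huv hup
      refine ⟨strictMono_fin_cons ha hp, fun i => ?_⟩
      induction i using Fin.cases with
      | zero => simpa using hup
      | succ i =>
        have h1 := mul_neg_of_neg_of_pos huv (hs i)
        have h2 : 0 < v ^ 2 := by
          have := right_ne_zero_of_mul huv.ne
          positivity
        simp only [Fin.val_succ, Fin.cons_succ, pow_succ]
        by_contra! h3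
        nlinarith [mul_nonpos_of_nonneg_of_nonpos h2.le h3]
    obtain ⟨L, a, hL, ha, hqa, hs⟩ := ih (q := fun j => q j.succ) (τ := fun i => τ i.succ)
      (fun i => hτ i.succ) (fun j => hq _) (fun i => c i.succ) (fun i => hc i.succ)
    simp only [Fin.succ_zero_eq_one] at hqa hs
    have h0 := hτ 0
    have h00 := mul_self_pos.mpr (hq 0)
    simp only [Fin.castSucc_zero, Fin.succ_zero_eq_one] at h0
    have h01 := h0.1.trans h0.2
    rw [Fin.sum_univ_succ]
    rcases hc 0 with ⟨h1, h2⟩ | ⟨h1, h2⟩ | ⟨h1, h2, h3⟩ <;>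
      simp only [Fin.castSucc_zero, Fin.succ_zero_eq_one] at h2 <;> rw [h1]
    · refine ⟨L, a, by omega, ha, fun i => h01.le.trans (hqa i), fun i => ?_⟩
      have h4 := mul_pos h2 (hs i)
      have h5 : 0 < f (q 1) ^ 2 := by have := hq 1; positivity
      by_contra! h6
      nlinarith [mul_nonpos_of_nonneg_of_nonpos h5.le h6]
    · obtain ⟨h4, h5⟩ := hcons ha (fun i => h01.trans_le (hqa i)) hs h2 h00
      refine ⟨L + 1, _, by omega, h4, fun i => ?_, h5⟩
      simpa using h4.monotone (Fin.zero_le i)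
    · rw [Fin.castSucc_zero] at h3
      have h6 : f (τ 0) * f (q 1) < 0 := by
        by_contra! h6
        nlinarith [mul_pos h2 h00, mul_nonneg h6 h00.le]
      obtain ⟨h4, h5⟩ := hcons ha (fun i => h0.2.trans_le (hqa i)) hs h6
        (mul_self_pos.mpr (left_ne_zero_of_mul h6.ne))
      have h7 : ∀ i : Fin (L + 1), q 0 < (Fin.cons (τ 0) a : Fin (L + 1) → ℝ) i := fun i =>
        h0.1.trans_le (by simpa using h4.monotone (Fin.zero_le i))
      obtain ⟨h8, h9⟩ := hcons h4 h7 h5 h3 h00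
      refine ⟨L + 2, _, by omega, h8, fun i => ?_, h9⟩
      simpa using h8.monotone (Fin.zero_le i)

theorem ratioWronskian_add {n : ℕ} (w x h h' : Fin n → ℝ) (m : ℝ) :
    ratioWronskian w x (h + h') m = ratioWronskian w x h m + ratioWronskian w x h' m := by
  have hadd : ∀ u v : Fin n → ℝ, expSum (u + v) x m = expSum u x m + expSum v x m := fun u v => by
    simp [expSum, add_mul, Finset.sum_add_distrib]
  simp only [ratioWronskian, mul_add, add_mul, hadd]
  ring

theorem ratioWronskian_smul {n : ℕ} (w x h : Fin n → ℝ) (c m : ℝ) :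
    ratioWronskian w x (c • h) m = c * ratioWronskian w x h m := by
  have hsmul : ∀ u : Fin n → ℝ, expSum (c • u) x m = c * expSum u x m := fun u => by
    simp [expSum, mul_assoc, Finset.mul_sum]
  simp only [ratioWronskian, mul_smul_comm, smul_mul_assoc, hsmul]
  ring

/-- The directional derivatives of the entropies at chosen orders can be prescribed by moving as
many nonzero gaps. -/
theorem exists_ratioWronskian_eq {n : ℕ} {b : Fin n → ℝ} (hb : ∀ k, 0 ≤ b k) {τ : Fin n → ℝ}
    (hτ : StrictMono τ) {E G : Finset (Fin n)} (hG : ∀ k ∈ G, 0 < b k) (hEG : E.card = G.card)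
    (y : Fin n → ℝ) : ∃ v : Fin n → ℝ, (∀ k ∉ G, v k = 0) ∧
      ∀ i ∈ E, ratioWronskian 1 (gapSum b) (gapSum v) (τ i) = y i := by
  let ext : (G → ℝ) →ₗ[ℝ] (Fin n → ℝ) :=
    { toFun := fun u k => if h : k ∈ G then u ⟨k, h⟩ else 0
      map_add' := fun u u' => by
        ext k
        by_cases h : k ∈ G <;> simp [h]
      map_smul' := fun c u => by
        ext k
        by_cases h : k ∈ G <;> simp [h] }
  have hext : ∀ u (k : G), ext u k = u k := fun u k => dif_pos k.2
  have hext0 : ∀ u, ∀ k ∉ G, ext u k = 0 := fun u k hk => dif_neg hk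
  let T : (G → ℝ) →ₗ[ℝ] (E → ℝ) :=
    { toFun := fun u i => ratioWronskian 1 (gapSum b) (gapSum (ext u)) (τ i)
      map_add' := fun u u' => by
        ext i
        simp only [map_add, ratioWronskian_add, Pi.add_apply]
      map_smul' := fun c u => by
        ext i
        simp only [map_smul, ratioWronskian_smul, Pi.smul_apply, smul_eq_mul, RingHom.id_apply] }
  have hinj : Function.Injective T := by
    rw [injective_iff_map_eq_zero]
    intro u hu
    by_contra hne
    obtain ⟨k, hk⟩ := Function.ne_iff.mp hne
    have hcard : 0 < E.card := hEG ▸ Finset.card_pos.mpr ⟨k, k.2⟩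
    have halt : ∀ s : ℝ, s ≠ 0 → HasAlternation (ext u) E.card s := fun s hs => by
      have := hasAlternation_of_ratioWronskian (w := 1) (x := gapSum b) (h := gapSum (ext u))
        (fun _ => one_pos) (gapSum_monotone hb)
        (fun i j => gapSum_eq_of_gapSum_eq hb fun l hl =>
          hext0 u l fun h => (hG l h).ne' hl)
        ⟨k, by simpa [gapSum_succ_sub_castSucc, hext] using hk⟩ hs
        (hτ.comp (E.orderEmbOfFin rfl).strictMono) fun i => by
          have := congrFun hu ⟨_, E.orderEmbOfFin_mem rfl i⟩
          simp only [Function.comp_apply]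
          rw [show ratioWronskian 1 (gapSum b) (gapSum (ext u)) (τ (E.orderEmbOfFin rfl i)) = 0
            from this, mul_zero]
      simpa only [gapSum_succ_sub_castSucc] using this
    rcases (halt 1 one_ne_zero).exists_succ hcard (halt (-1) (by norm_num)) with h | h <;>
    · have := h.le_card G (hext0 u)
      omega
  have hsurj : Function.Surjective T :=
    (LinearMap.injective_iff_surjective_of_finrank_eq_finrank (by simp [hEG])).mp hinj
  obtain ⟨u, hu⟩ := hsurj fun i => y i
  exact ⟨ext u, hext0 u, fun i hi => congrFun hu ⟨i, hi⟩⟩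

theorem exists_gapEntropy_ne {n : ℕ} {a b : Fin n → ℝ}
    (h : ∃ t, gapEntropy b t - gapEntropy a t ≠ 0) {p q : ℝ} (hpq : p < q) :
    ∃ t ∈ Set.Ioo p q, gapEntropy b t - gapEntropy a t ≠ 0 := by
  by_contra! hcon
  obtain ⟨t, ht⟩ := h
  obtain ⟨c, hc⟩ := exists_between hpq
  refine ht (((analyticOnNhd_gapEntropy b).sub (analyticOnNhd_gapEntropy a)
    ).eqOn_zero_of_preconnected_of_eventuallyEq_zero isPreconnected_univ (Set.mem_univ c) ?_
    (Set.mem_univ t))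
  filter_upwards [Ioo_mem_nhds hc.1 hc.2] with t ht using hcon t ht

theorem exists_interlacing {P : ℝ → Prop} (hP : ∀ p q, p < q → ∃ t ∈ Set.Ioo p q, P t) {n : ℕ}
    {τ : Fin n → ℝ} (hτ : StrictMono τ) :
    ∃ q : Fin (n + 1) → ℝ, (∀ i, q i.castSucc < τ i ∧ τ i < q i.succ) ∧ ∀ j, P (q j) := by
  have key : ∀ j : Fin (n + 1), ∃ t, P t ∧ (∀ i : Fin n, i.succ ≤ j → τ i < t) ∧
      ∀ i : Fin n, j ≤ i.castSucc → t < τ i := fun j => by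
    obtain ⟨p, hp⟩ := Order.exists_between_finsets
      (lo := (Finset.univ.filter fun i : Fin n => i.succ ≤ j).image τ)
      (hi := (Finset.univ.filter fun i : Fin n => j ≤ i.castSucc).image τ) (by
        simp only [Finset.mem_image, Finset.mem_filter_univ]
        rintro _ ⟨i, hi, rfl⟩ _ ⟨k, hk, rfl⟩
        exact hτ (Fin.succ_le_castSucc_iff.mp (hi.trans hk)))
    obtain ⟨q, hq⟩ := Order.exists_between_finsets (lo := {p})
      (hi := (Finset.univ.filter fun i : Fin n => j ≤ i.castSucc).image τ) (by
        simpa using hp.2)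
    obtain ⟨t, ht, hPt⟩ := hP p q (hq.1 p (by simp))
    exact ⟨t, hPt, fun i hi => (hp.1 _ (Finset.mem_image_of_mem _ (by simpa using hi))).trans ht.1,
      fun i hi => ht.2.trans (hq.2 _ (Finset.mem_image_of_mem _ (by simpa using hi)))⟩
  choose q hq using key
  exact ⟨q, fun i => ⟨(hq _).2.2 i le_rfl, (hq _).2.1 i le_rfl⟩, fun j => (hq j).1⟩

theorem mul_mul_pos_of_mul_pos {u v w z : ℝ} (h₁ : 0 < u * w) (h₂ : 0 < v * z) (h : 0 < u * v) :
    0 < w * z := by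
  by_contra! hle
  nlinarith [mul_pos h₁ h₂, mul_nonpos_of_nonneg_of_nonpos h.le hle]

/-- If two entropies agree at as many orders as there are gaps, then they agree at all orders,
provided that `b` accounts for at least half of the nonzero gaps. -/
theorem gapEntropy_sub_eq_zero_of_card_le {n : ℕ} {a b : Fin n → ℝ} (ha : ∀ k, 0 ≤ a k)
    (hb : ∀ k, 0 ≤ b k) {τ : Fin n → ℝ} (hτ : StrictMono τ)
    (hab : ∀ i, gapEntropy b (τ i) - gapEntropy a (τ i) = 0)
    (hcard : (Finset.univ.filter fun k => a k ≠ 0 ∨ b k ≠ 0).card ≤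
      2 * (Finset.univ.filter fun k => b k ≠ 0).card) (t : ℝ) :
    gapEntropy b t - gapEntropy a t = 0 := by
  classical
  by_contra hne
  obtain ⟨q, hqτ, hq⟩ := exists_interlacing
    (fun p q hpq => exists_gapEntropy_ne (a := a) (b := b) ⟨t, hne⟩ hpq) hτ
  set D : Fin (n + 1) → ℝ := fun j => gapEntropy b (q j) - gapEntropy a (q j)
  set E : Finset (Fin n) := Finset.univ.filter fun i => 0 < D i.castSucc * D i.succ
  set B : Finset (Fin n) := Finset.univ.filter fun k => b k ≠ 0
  obtain ⟨E', hE'E, hE'⟩ := Finset.exists_subset_card_eq (min_le_left E.card B.card)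
  obtain ⟨G, hGB, hG⟩ := Finset.exists_subset_card_eq (min_le_right E.card B.card)
  have hGpos : ∀ k ∈ G, 0 < b k := fun k hk =>
    lt_of_le_of_ne (hb k) (Finset.mem_filter_univ k |>.mp (hGB hk)).symm
  obtain ⟨v, hv0, hv⟩ := exists_ratioWronskian_eq hb (Real.exp_strictMono.comp hτ) hGpos
    (hE'.trans hG.symm) fun i => -D i.castSucc
  have hline : Continuous fun ε : ℝ => b + ε • v := by fun_prop
  have hnonneg : ∀ᶠ ε in nhdsWithin (0 : ℝ) (Set.Ioi 0), ∀ k, 0 ≤ (b + ε • v) k := by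
    refine Filter.eventually_all.mpr fun k => ?_
    by_cases hk : k ∈ G
    · have hc : Continuous fun ε : ℝ => (b + ε • v) k := (continuous_apply k).comp hline
      exact ((hc.tendsto 0).eventually_const_lt (by simpa using hGpos k hk)).filter_mono
        nhdsWithin_le_nhds |>.mono fun _ => le_of_lt
    · exact .of_forall fun ε => by simpa [hv0 k hk] using hb k
  have hsign : ∀ᶠ ε in nhdsWithin (0 : ℝ) (Set.Ioi 0), ∀ j,
      0 < D j * (gapEntropy (b + ε • v) (q j) - gapEntropy a (q j)) := by
    refine Filter.eventually_all.mpr fun j => ?_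
    have hc : Continuous fun ε : ℝ =>
        D j * (gapEntropy (b + ε • v) (q j) - gapEntropy a (q j)) :=
      continuous_const.mul (((continuous_gapEntropy_left _).comp hline).sub continuous_const)
    exact ((hc.tendsto 0).eventually_const_lt
      (by simpa only [zero_smul, add_zero] using mul_self_pos.mpr (hq j))).filter_mono
      nhdsWithin_le_nhds
  have hflip : ∀ᶠ ε in nhdsWithin (0 : ℝ) (Set.Ioi 0), ∀ i ∈ E',
      D i.castSucc * (gapEntropy (b + ε • v) (τ i) - gapEntropy a (τ i)) < 0 := by
    refine Filter.eventually_all.mpr fun i => ?_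
    by_cases hi : i ∈ E'
    swap
    · exact .of_forall fun ε h => absurd h hi
    have h1 : HasDerivAt (fun ε : ℝ => b + ε • v) v 0 := by
      simpa using ((hasDerivAt_id (0 : ℝ)).smul_const v).const_add b
    have h2 := HasFDerivAt.comp_hasDerivAt (0 : ℝ)
      (by simpa using hasFDerivAt_gapEntropy b (τ i)) h1
    have h3 := (h2.sub_const (gapEntropy a (τ i))).const_mul (D i.castSucc)
    have hneg : D i.castSucc * ((fderiv ℝ (negEntropy (Real.exp (τ i))) (gapSum b)).comp gapSum) v
        < 0 := by
      rw [ContinuousLinearMap.comp_apply, fderiv_negEntropy,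
        show ratioWronskian 1 (gapSum b) (gapSum v) (Real.exp (τ i)) = -D i.castSucc from hv i hi]
      have h4 := expSum_one_pos (gapSum b) (Real.exp (τ i))
      have h5 : D i.castSucc ≠ 0 := hq _
      have : 0 < Real.exp (τ i) ^ 2 * D i.castSucc ^ 2 /
        expSum 1 (gapSum b) (Real.exp (τ i)) ^ 2 := by positivity
      rw [← neg_pos]
      convert this using 1
      ring
    have h4 := (hasDerivWithinAt_iff_tendsto_slope' (s := Set.Ioi (0 : ℝ)) (by simp)).mp
      h3.hasDerivWithinAt
    filter_upwards [h4.eventually_lt_const hneg, self_mem_nhdsWithin] with ε hε hε0 _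
    have hab' := hab i
    rw [slope_def_field, sub_zero, div_lt_iff₀ hε0, zero_mul] at hε
    simpa [hab'] using hε
  obtain ⟨ε, hεb, hεs, hεf⟩ := (hnonneg.and (hsign.and hflip)).exists
  set c : Fin n → ℕ := fun i => if i ∈ E' then 2 else if i ∈ E then 0 else 1 with hc
  obtain ⟨L, P, hL, hP, -, hPs⟩ := exists_alternation_of_interlacing
    (f := fun t => gapEntropy (b + ε • v) t - gapEntropy a t) hqτ
    (fun j => right_ne_zero_of_mul (hεs j).ne') c fun i => by
      by_cases hi : i ∈ E
      · have h1 := mul_mul_pos_of_mul_pos (hεs i.castSucc) (hεs i.succ)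
          (Finset.mem_filter_univ i |>.mp hi)
        by_cases hi' : i ∈ E'
        · refine .inr (.inr ⟨by simp [hc, hi'], h1, ?_⟩)
          have h2 := hεs i.castSucc
          have h3 := mul_mul_pos_of_mul_pos h2
            (z := -(gapEntropy (b + ε • v) (τ i) - gapEntropy a (τ i))) (v := D i.castSucc)
            (by have := hεf i hi'; linarith) (mul_self_pos.mpr (hq _))
          linarith
        · exact .inl ⟨by simp [hc, hi, hi'], h1⟩
      · have hi' : i ∉ E' := fun h => hi (hE'E h)
        refine .inr (.inl ⟨by simp [hc, hi, hi'], ?_⟩)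
        have h1 : D i.castSucc * D i.succ < 0 :=
          lt_of_le_of_ne (not_lt.mp fun h => hi ((Finset.mem_filter_univ i).mpr h))
            (mul_ne_zero (hq _) (hq _))
        have h2 := mul_mul_pos_of_mul_pos (hεs i.castSucc)
          (v := -D i.succ) (z := -(gapEntropy (b + ε • v) (q i.succ) - gapEntropy a (q i.succ)))
          (by have := hεs i.succ; linarith) (by linarith)
        linarith
  have hle := (hasAlternation_sub_of_gapEntropy ha hεb ⟨P, hP, hPs⟩).le_card
    (Finset.univ.filter fun k => a k ≠ 0 ∨ b k ≠ 0) fun k hk => by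
      simp only [Finset.mem_filter_univ, not_or, not_not] at hk
      have : v k = 0 := hv0 k fun h => (hGpos k h).ne' hk.2
      simp [hk, this]
  have hle' : (Finset.univ.filter fun k => a k ≠ 0 ∨ b k ≠ 0).card ≤ n := by
    simpa using Finset.card_le_univ (Finset.univ.filter fun k => a k ≠ 0 ∨ b k ≠ 0)
  have hsum : ∑ i, c i + E.card = n + 2 * E'.card := by
    have h1 : ∀ i, c i + (if i ∈ E then 1 else 0) = 1 + 2 * if i ∈ E' then 1 else 0 := fun i => by
      by_cases hi' : i ∈ E'
      · simp [hc, hi', hE'E hi']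
      · by_cases hi : i ∈ E <;> simp [hc, hi, hi']
    have h2 := Finset.sum_congr (rfl : (Finset.univ : Finset (Fin n)) = _) fun i _ => h1 i
    simpa [Finset.sum_add_distrib, ← Finset.mul_sum, mul_comm] using h2
  have hE'n : E.card ≤ n := by simpa using Finset.card_le_univ E
  rcases le_total E.card B.card with h | h
  · rw [min_eq_left h] at hE'
    omega
  · rw [min_eq_right h] at hE'
    omega

theorem gapEntropy_eq_of_forall_eq {n : ℕ} {a b : Fin n → ℝ} (ha : ∀ k, 0 ≤ a k)
    (hb : ∀ k, 0 ≤ b k) {τ : Fin n → ℝ} (hτ : StrictMono τ)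
    (hab : ∀ i, gapEntropy a (τ i) = gapEntropy b (τ i)) (t : ℝ) :
    gapEntropy a t = gapEntropy b t := by
  classical
  have hor : (Finset.univ.filter fun k => a k ≠ 0 ∨ b k ≠ 0).card ≤
      (Finset.univ.filter fun k => a k ≠ 0).card + (Finset.univ.filter fun k => b k ≠ 0).card := by
    rw [Finset.filter_or]
    exact Finset.card_union_le _ _
  rcases le_total (Finset.univ.filter fun k => a k ≠ 0).card
    (Finset.univ.filter fun k => b k ≠ 0).card with h | h
  · exact (sub_eq_zero.mp (gapEntropy_sub_eq_zero_of_card_le ha hb hτ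
      (fun i => sub_eq_zero.mpr (hab i).symm) (by omega) t)).symm
  · refine sub_eq_zero.mp (gapEntropy_sub_eq_zero_of_card_le hb ha hτ
      (fun i => sub_eq_zero.mpr (hab i)) ?_ t)
    simp only [or_comm (a := b _ ≠ 0)]
    omega

theorem expSum_one_log {n : ℕ} {p : Fin n → ℝ} (hp : ∀ i, 0 < p i) (m : ℝ) :
    expSum 1 (fun i => Real.log (p i)) m = ∑ i, p i ^ m := by
  refine Finset.sum_congr rfl fun i _ => ?_
  rw [Real.rpow_def_of_pos (hp i), mul_comm m, Pi.one_apply, one_mul]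

theorem GSE_eq_neg_negEntropy {n : ℕ} {p : Fin (n + 1) → ℝ} (hp : ∀ i, 0 < p i) (m : ℝ) :
    GSE (n + 1) m p = -negEntropy m fun i => Real.log (p i) := by
  have hpos := expSum_one_pos (fun i => Real.log (p i)) m
  rw [GSE, neg_inj, ← expSum_one_log hp, negEntropy]
  have h1 : ∀ k, Real.log (p k ^ m / expSum 1 (fun i => Real.log (p i)) m) =
      m * Real.log (p k) - Real.log (expSum 1 (fun i => Real.log (p i)) m) := fun k => by
    rw [Real.log_div (Real.rpow_pos_of_pos (hp k) m).ne' hpos.ne', Real.log_rpow (hp k)]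
  simp only [h1, mul_sub, Finset.sum_sub_distrib, ← Finset.sum_mul, ← Finset.sum_div]
  rw [← expSum_one_log hp, div_self hpos.ne', one_mul, sub_left_inj, mul_div_assoc,
    expSum.eq_def fun i => Real.log (p i), Finset.sum_div, Finset.mul_sum]
  refine Finset.sum_congr rfl fun k _ => ?_
  rw [Real.rpow_def_of_pos (hp k), mul_comm (Real.log (p k)) m]
  ring

theorem expSum_comp_perm {n : ℕ} (w x : Fin n → ℝ) (σ : Equiv.Perm (Fin n)) (m : ℝ) :
    expSum (w ∘ σ) (x ∘ σ) m = expSum w x m :=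
  Equiv.sum_comp σ fun i => w i * Real.exp (m * x i)

theorem negEntropy_comp_perm {n : ℕ} (m : ℝ) (x : Fin n → ℝ) (σ : Equiv.Perm (Fin n)) :
    negEntropy m (x ∘ σ) = negEntropy m x := by
  rw [negEntropy, expSum_comp_perm, show expSum 1 (x ∘ σ) m = expSum 1 x m from
    expSum_comp_perm 1 x σ m]
  rfl

theorem negEntropy_sub_const {n : ℕ} (m : ℝ) (x : Fin (n + 1) → ℝ) (c : ℝ) :
    negEntropy m (fun i => x i - c) = negEntropy m x := by
  have hpos := expSum_one_pos x m
  have h1 : expSum (fun i => x i - c) x m = expSum x x m - c * expSum 1 x m := by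
    simp only [expSum, Finset.mul_sum, ← Finset.sum_sub_distrib, Pi.one_apply]
    exact Finset.sum_congr rfl fun i _ => by ring
  have h2 := Real.exp_pos (-(m * c))
  rw [negEntropy, negEntropy, expSum_sub_const, expSum_sub_const, h1,
    Real.log_mul h2.ne' hpos.ne', Real.log_exp]
  field_simp
  ring

theorem exists_gapEntropy_eq {n : ℕ} (x : Fin (n + 1) → ℝ) :
    ∃ a : Fin n → ℝ, (∀ k, 0 ≤ a k) ∧ ∀ τ, gapEntropy a τ = negEntropy (Real.exp τ) x := by
  set y := x ∘ Tuple.sort x with hy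
  refine ⟨fun k => y k.succ - y k.castSucc, fun k =>
    sub_nonneg.mpr (Tuple.monotone_sort x (Fin.castSucc_lt_succ (i := k)).le), fun τ => ?_⟩
  have h : gapSum (fun k => y k.succ - y k.castSucc) = fun i => y i - y 0 := by
    ext i
    induction i using Fin.induction with
    | zero => simp [gapSum_apply]
    | succ i hi =>
      have := gapSum_succ_sub_castSucc (fun k => y k.succ - y k.castSucc) i
      linarith
  rw [gapEntropy, h, negEntropy_sub_const, hy, negEntropy_comp_perm]

theorem expSum_one_eq_of_negEntropy_eq {n : ℕ} {x y : Fin (n + 1) → ℝ}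
    (h : ∀ m, 0 < m → negEntropy m x = negEntropy m y) (h1 : expSum 1 x 1 = expSum 1 y 1)
    {m : ℝ} (hm : 0 < m) : expSum 1 x m = expSum 1 y m := by
  have hderiv : ∀ (x : Fin (n + 1) → ℝ) (m : ℝ), 0 < m →
      HasDerivAt (fun m => Real.log (expSum 1 x m) / m) (negEntropy m x / m ^ 2) m := by
    intro x m hm
    have hpos := expSum_one_pos x m
    refine (((hasDerivAt_expSum 1 x m).log hpos.ne').div (hasDerivAt_id m) hm.ne').congr_deriv ?_
    rw [one_mul, negEntropy, id]
    ring
  have hconst : ∀ t ∈ Set.Ioi (0 : ℝ), deriv (fun m => Real.log (expSum 1 x m) / m -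
      Real.log (expSum 1 y m) / m) t = 0 := fun t ht => by
    rw [((hderiv x t ht).fun_sub (hderiv y t ht)).deriv, h t ht, sub_self]
  have h2 := isOpen_Ioi.is_const_of_deriv_eq_zero isPreconnected_Ioi
    (fun t ht => ((hderiv x t ht).fun_sub
      (hderiv y t ht)).differentiableAt.differentiableWithinAt) hconst hm
    (Set.mem_Ioi.mpr one_pos)
  simp only [h1, sub_self] at h2
  rw [← sub_div, div_eq_zero_iff, or_iff_left hm.ne'] at h2
  exact Real.log_injOn_pos (expSum_one_pos x m) (expSum_one_pos y m) (sub_eq_zero.mp h2)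

/-- Tuples with the same power sums are permutations of each other. -/
theorem exists_perm_of_sum_pow_eq {ι : Type*} [Fintype ι] {p q : ι → ℝ}
    (h : ∀ k : ℕ, ∑ i, p i ^ k = ∑ i, q i ^ k) : ∃ σ : Equiv.Perm ι, q = p ∘ σ := by
  classical
  have hpoly : ∀ P : Polynomial ℝ, ∑ i, P.eval (p i) = ∑ i, P.eval (q i) := fun P => by
    simp only [Polynomial.eval_eq_sum_range]
    rw [Finset.sum_comm, Finset.sum_comm (s := Finset.univ)]
    simp only [← Finset.mul_sum, h]
  have hcount : ∀ c, Fintype.card {i // q i = c} = Fintype.card {i // p i = c} := fun c => by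
    let V : Finset ℝ := (Finset.univ.image p ∪ Finset.univ.image q).erase c
    let P : Polynomial ℝ := ∏ v ∈ V, (Polynomial.X - Polynomial.C v)
    have heval : ∀ u, P.eval u = ∏ v ∈ V, (u - v) := fun u => by
      simp [P, Polynomial.eval_prod]
    have hPc : P.eval c ≠ 0 := by
      rw [heval, Finset.prod_ne_zero_iff]
      exact fun v hv => sub_ne_zero.mpr (Finset.ne_of_mem_erase hv).symm
    have hsum : ∀ u : ι → ℝ, (∀ i, u i ∈ Finset.univ.image p ∪ Finset.univ.image q) →
        ∑ i, P.eval (u i) = Fintype.card {i // u i = c} * P.eval c := fun u hu => by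
      rw [Fintype.card_subtype, ← nsmul_eq_mul, ← Finset.sum_const, Finset.sum_filter]
      refine Finset.sum_congr rfl fun i _ => ?_
      split_ifs with hi
      · rw [hi]
      · rw [heval]
        exact Finset.prod_eq_zero (Finset.mem_erase.mpr ⟨hi, hu i⟩) (sub_self _)
    have h1 := hpoly P
    rw [hsum p (by simp), hsum q (by simp)] at h1
    exact_mod_cast (mul_right_cancel₀ hPc h1).symm
  refine ⟨Equiv.ofFiberEquiv fun c => Fintype.equivOfCardEq (hcount c), ?_⟩
  ext i
  exact (Equiv.ofFiberEquiv_map _ i).symm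

/-- For `K ≥ 2`, any `r ≥ K - 1` distinct positive orders of GSE determine a
positive probability vector on `Fin K` up to permutation. -/
theorem gse_finite_order_characterization_sufficient
    (K r : ℕ) (hK : 2 ≤ K)
    (M : Finset ℝ) (hMpos : ∀ m ∈ M, 0 < m) (hMcard : M.card = r) (hr : K - 1 ≤ r)
    (p q : Fin K → ℝ)
    (hp : ∀ i, 0 < p i) (hq : ∀ i, 0 < q i)
    (hpsum : ∑ i, p i = 1) (hqsum : ∑ i, q i = 1)
    (hH : ∀ m ∈ M, GSE K m p = GSE K m q) :
    ∃ σ : Equiv.Perm (Fin K), q = p ∘ σ := by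
  obtain ⟨n, rfl⟩ : ∃ n, K = n + 1 := ⟨K - 1, by omega⟩
  obtain ⟨M', hM', hcard⟩ := Finset.exists_subset_card_eq (s := M) (n := n) (by omega)
  set m := M'.orderEmbOfFin hcard
  have hm : ∀ i, m i ∈ M := fun i => hM' (M'.orderEmbOfFin_mem hcard i)
  obtain ⟨a, ha, hap⟩ := exists_gapEntropy_eq fun i => Real.log (p i)
  obtain ⟨b, hb, hbq⟩ := exists_gapEntropy_eq fun i => Real.log (q i)
  have hab := gapEntropy_eq_of_forall_eq ha hb (τ := fun i => Real.log (m i))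
    (fun i j hij => Real.log_lt_log (hMpos _ (hm i)) (m.strictMono hij)) fun i => by
      have := hH _ (hm i)
      rw [GSE_eq_neg_negEntropy hp, GSE_eq_neg_negEntropy hq, neg_inj] at this
      rwa [hap, hbq, Real.exp_log (hMpos _ (hm i))]
  have hent : ∀ t, 0 < t → negEntropy t (fun i => Real.log (p i)) =
      negEntropy t fun i => Real.log (q i) := fun t ht => by
    simpa only [hap, hbq, Real.exp_log ht] using hab (Real.log t)
  refine exists_perm_of_sum_pow_eq fun k => ?_
  rcases Nat.eq_zero_or_pos k with rfl | hk
  · simp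
  have hk' : (0 : ℝ) < k := by exact_mod_cast hk
  simpa [expSum_one_log hp, expSum_one_log hq] using
    expSum_one_eq_of_negEntropy_eq hent
      (by simp [expSum_one_log hp, expSum_one_log hq, hpsum, hqsum]) hk'
end

section
/- Let K ≥ 3 and let M ⊂ (0,∞) be a set of r distinct positive real numbers with r ≤ K−2. Then there exist two distinct probability vectors p ≠ q, both with strictly decreasing positive entries p_1 > p_2 > ⋯ > p_K > 0 and q_1 > q_2 > ⋯ > q_K > 0 summing to 1 (hence each without multiplicity, and q is not a permutation of p), such that H_m(p) = H_m(q) for every m ∈ M. -/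
open scoped Topology

/-- Near a regular point `a`, the level set through `a` of a `C^1` function is locally
parametrized by the kernel of its derivative. -/
theorem exists_levelSet_parametrization {E : Type*} [NormedAddCommGroup E] [NormedSpace ℝ E]
    [FiniteDimensional ℝ E] {g : E → ℝ} {U : Set E} {a : E} (hU : IsOpen U) (ha : a ∈ U)
    (hg : ContDiffAt ℝ 1 g a) (hga : fderiv ℝ g a ≠ 0) :
    ∃ (V : Set (fderiv ℝ g a).ker) (ψ : (fderiv ℝ g a).ker → E), IsOpen V ∧ V.Nonempty ∧
      ContDiffOn ℝ 1 ψ V ∧ Set.InjOn ψ V ∧ Set.MapsTo ψ V U ∧ ∀ y ∈ V, g (ψ y) = g a := by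
  have hstrict := hg.hasStrictFDerivAt one_ne_zero
  let φ := hstrict.implicitFunctionDataOfComplemented g (fderiv ℝ g a)
    (Module.Dual.range_eq_top_of_ne_zero (ContinuousLinearMap.coe_injective.ne hga))
    (fderiv ℝ g a).ker_closedComplemented_of_finiteDimensional_range
  have hr : ContDiffAt ℝ 1 φ.rightFun φ.pt :=
    φ.rightDeriv.contDiff.contDiffAt.comp a (contDiffAt_id.sub contDiffAt_const)
  let ψ := φ.implicitFunction (φ.leftFun φ.pt)
  let y₀ := φ.rightFun φ.pt
  have hψ : ContDiffAt ℝ 1 ψ y₀ :=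
    (φ.contDiffAt_implicitFunction hg hr one_ne_zero).comp y₀
      (contDiffAt_const.prodMk contDiffAt_id)
  have hψy₀ : ψ y₀ = a := φ.implicitFunction_apply_image.self_of_nhds
  have hslice : Filter.Tendsto (fun y => (φ.leftFun φ.pt, y)) (𝓝 y₀) (𝓝 (φ.prodFun φ.pt)) :=
    (Continuous.prodMk_right _).tendsto y₀
  have hev : ∀ᶠ y in 𝓝 y₀, ContDiffAt ℝ 1 ψ y ∧ ψ y ∈ U ∧ g (ψ y) = g a ∧
      φ.rightFun (ψ y) = y :=
    (hψ.eventually (by simp)).and <|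
      (hψ.continuousAt.eventually_mem (hψy₀ ▸ hU.mem_nhds ha)).and <|
        (hslice.eventually φ.leftFun_implicitFunction).and
          (hslice.eventually φ.rightFun_implicitFunction)
  obtain ⟨V, hV, hVo, hyV⟩ := eventually_nhds_iff.1 hev
  refine ⟨V, ψ, hVo, ⟨y₀, hyV⟩, fun y hy => (hV y hy).1.contDiffWithinAt, ?_,
    fun y hy => (hV y hy).2.1, fun y hy => (hV y hy).2.2.1⟩
  intro y hy z hz hyz
  rw [← (hV y hy).2.2.2, ← (hV z hz).2.2.2, hyz]

/-- Fewer than `dim E` real-valued `C^1` functions cannot separate the points of a nonempty open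
subset of `E`. -/
theorem exists_ne_of_contDiffOn_of_card_lt_finrank {ι : Type*} (s : Finset ι) :
    ∀ (E : Type) [NormedAddCommGroup E] [NormedSpace ℝ E] [FiniteDimensional ℝ E]
      (f : ι → E → ℝ) (U : Set E), IsOpen U → U.Nonempty →
      (∀ i ∈ s, ContDiffOn ℝ 1 (f i) U) → s.card < Module.finrank ℝ E →
      ∃ x ∈ U, ∃ y ∈ U, x ≠ y ∧ ∀ i ∈ s, f i x = f i y := by
  classical
  induction s using Finset.induction_on with
  | empty =>
    intro E _ _ _ f U hU hne _ hcard
    have : Nontrivial E := Module.nontrivial_of_finrank_pos (R := ℝ) (by simpa using hcard)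
    obtain ⟨x, hx⟩ := hne
    have := Module.punctured_nhds_neBot ℝ E x
    obtain ⟨y, hy, hyx⟩ :=
      (infinite_of_mem_nhds x (hU.mem_nhds hx)).nontrivial.exists_ne x
    exact ⟨x, hx, y, hy, hyx.symm, by simp⟩
  | insert j s hj ih =>
    intro E _ _ _ f U hU hne hf hcard
    rw [Finset.card_insert_of_notMem hj] at hcard
    have hfj := hf j (Finset.mem_insert_self j s)
    by_cases h : ∀ x ∈ U, fderiv ℝ (f j) x = 0
    · obtain ⟨a, ha⟩ := hne
      obtain ⟨ε, hε, hball⟩ := Metric.isOpen_iff.1 hU a ha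
      obtain ⟨x, hx, y, hy, hxy, heq⟩ := ih E f (Metric.ball a ε) Metric.isOpen_ball
        ⟨a, Metric.mem_ball_self hε⟩
        (fun i hi => (hf i (Finset.mem_insert_of_mem hi)).mono hball) (by omega)
      refine ⟨x, hball hx, y, hball hy, hxy, Finset.forall_mem_insert _ _ _ |>.2 ⟨?_, heq⟩⟩
      exact Metric.isOpen_ball.is_const_of_fderiv_eq_zero
        (convex_ball a ε).isPreconnected ((hfj.mono hball).differentiableOn one_ne_zero)
        (fun z hz => h z (hball hz)) hx hy
    · push Not at h
      obtain ⟨a, ha, hfa⟩ := h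
      obtain ⟨V, ψ, hVo, hVne, hψ, hinj, hmaps, hlevel⟩ := exists_levelSet_parametrization hU ha
        (hfj.contDiffAt (hU.mem_nhds ha)) hfa
      have hdim : Module.finrank ℝ (fderiv ℝ (f j) a).ker + 1 = Module.finrank ℝ E :=
        Module.Dual.finrank_ker_add_one_of_ne_zero (ContinuousLinearMap.coe_injective.ne hfa)
      obtain ⟨x, hx, y, hy, hxy, heq⟩ := ih _ (fun i => f i ∘ ψ) V hVo hVne
        (fun i hi => (hf i (Finset.mem_insert_of_mem hi)).comp hψ hmaps) (by omega)
      exact ⟨ψ x, hmaps hx, ψ y, hmaps hy, hinj.ne hx hy hxy,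
        Finset.forall_mem_insert _ _ _ |>.2 ⟨(hlevel x hx).trans (hlevel y hy).symm, heq⟩⟩

/-- The GSE is invariant under scaling. -/
theorem GSE_div_const {K : ℕ} (m : ℝ) {p : Fin K → ℝ} (hp : ∀ i, 0 < p i) {c : ℝ} (hc : 0 < c) :
    GSE K m (fun i => p i / c) = GSE K m p := by
  have hcm : c ^ m ≠ 0 := (Real.rpow_pos_of_pos hc m).ne'
  simp only [GSE, Real.div_rpow (hp _).le hc.le, ← Finset.sum_div, div_div_div_cancel_right₀ hcm]

theorem contDiffOn_GSE {K : ℕ} (m : ℝ) {n : WithTop ℕ∞} :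
    ContDiffOn ℝ n (GSE K m) {p | ∀ i, 0 < p i} := by
  intro p hp
  apply ContDiffAt.contDiffWithinAt
  have hpow (i : Fin K) : ContDiffAt ℝ n (fun p : Fin K → ℝ => p i ^ m) p :=
    (contDiff_apply ℝ ℝ i).contDiffAt.rpow_const_of_ne (hp i).ne'
  have hsum : ContDiffAt ℝ n (fun p : Fin K → ℝ => ∑ i, p i ^ m) p :=
    ContDiffAt.sum fun i _ => hpow i
  refine ContDiffAt.neg (ContDiffAt.sum fun k _ => ?_)
  have hk : 0 < p k ^ m := Real.rpow_pos_of_pos (hp k) m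
  have hS : 0 < ∑ i, p i ^ m :=
    Finset.sum_pos (fun i _ => Real.rpow_pos_of_pos (hp i) m) ⟨k, Finset.mem_univ k⟩
  have hdiv := (hpow k).div hsum hS.ne'
  exact hdiv.mul (hdiv.log (div_pos hk hS).ne')

theorem isOpen_setOf_strictAnti_pos (K : ℕ) :
    IsOpen {p : Fin K → ℝ | StrictAnti p ∧ ∀ i, 0 < p i} := by
  simp only [StrictAnti, Set.ofPred_and, Set.ofPred_forall]
  refine IsOpen.inter ?_ (isOpen_iInter_of_finite fun i =>
    isOpen_lt continuous_const (continuous_apply i))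
  exact isOpen_iInter_of_finite fun i => isOpen_iInter_of_finite fun j =>
    isOpen_iInter_of_finite fun _ => isOpen_lt (continuous_apply j) (continuous_apply i)

/-- For `K ≥ 3` and any `r ≤ K - 2` distinct positive orders, GSE does not
identify distributions: there exist two distinct strictly decreasing positive probability
vectors (hence without multiplicity, and neither a permutation of the other) with the same
GSE of every order in `M`. -/
theorem gse_finite_order_characterization_necessary
    (K r : ℕ) (hK : 3 ≤ K)
    (M : Finset ℝ) (hMpos : ∀ m ∈ M, 0 < m) (hMcard : M.card = r) (hr : r ≤ K - 2) :
    ∃ p q : Fin K → ℝ,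
      p ≠ q ∧
      StrictAnti p ∧ StrictAnti q ∧
      (∀ i, 0 < p i) ∧ (∀ i, 0 < q i) ∧
      (∑ i, p i = 1) ∧ (∑ i, q i = 1) ∧
      (∀ m ∈ M, GSE K m p = GSE K m q) := by
  let f : Option ℝ → (Fin K → ℝ) → ℝ := fun o p => o.elim (∑ i, p i) fun m => GSE K m p
  obtain ⟨p, ⟨hpa, hp⟩, q, ⟨hqa, hq⟩, hpq, heq⟩ :=
    exists_ne_of_contDiffOn_of_card_lt_finrank M.insertNone (Fin K → ℝ) f
      {p | StrictAnti p ∧ ∀ i, 0 < p i} (isOpen_setOf_strictAnti_pos K)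
      ⟨fun i => (K : ℝ) - i,
        fun i j hij => sub_lt_sub_left (by exact_mod_cast hij) _,
        fun i => sub_pos.2 (by exact_mod_cast i.isLt)⟩
      (by
        rintro (_ | m) _
        · exact (ContDiff.sum fun i _ => contDiff_apply ℝ ℝ i).contDiffOn
        · exact (contDiffOn_GSE m).mono fun p hp => hp.2)
      (by simp; omega)
  have hsum : ∑ i, p i = ∑ i, q i := heq none (by simp)
  have : Nonempty (Fin K) := ⟨⟨0, by omega⟩⟩
  have hpos : 0 < ∑ i, p i := Finset.sum_pos (fun i _ => hp i) Finset.univ_nonempty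
  refine ⟨fun i => p i / ∑ i, p i, fun i => q i / ∑ i, p i, fun h => hpq ?_,
    fun i j hij => div_lt_div_of_pos_right (hpa hij) hpos,
    fun i j hij => div_lt_div_of_pos_right (hqa hij) hpos,
    fun i => div_pos (hp i) hpos, fun i => div_pos (hq i) hpos, ?_, ?_, fun m hm => ?_⟩
  · ext i
    exact (div_left_inj' hpos.ne').1 (congrFun h i)
  · rw [← Finset.sum_div, div_self hpos.ne']
  · rw [← Finset.sum_div, ← hsum, div_self hpos.ne']
  · rw [GSE_div_const m hp hpos, GSE_div_const m hq hpos]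
    exact heq (some m) (by simpa using hm)
end

section
/- Let K = 2 and fix any single order m > 0. If p = (p_1, p_2) and q = (q_1, q_2) are probability vectors with strictly positive entries, p_1 ≠ p_2, q_1 ≠ q_2, and H_m(p) = H_m(q), then q is a permutation of p. That is, for non-uniform binary distributions a single positive order of GSE determines the distribution up to permutation. -/
/-- Two points of the unit interval with equal binary entropy agree up to reflection. -/
theorem Real.eq_or_eq_one_sub_of_binEntropy_eq {x y : ℝ} (hx : x ∈ Set.Icc (0 : ℝ) 1)
    (hy : y ∈ Set.Icc (0 : ℝ) 1) (h : binEntropy x = binEntropy y) : x = y ∨ x = 1 - y := by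
  obtain ⟨hx0, hx1⟩ := hx
  obtain ⟨hy0, hy1⟩ := hy
  have inj := binEntropy_strictMonoOn.injOn
  rcases le_total x 2⁻¹ with hx2 | hx2 <;> rcases le_total y 2⁻¹ with hy2 | hy2
  · exact .inl (inj ⟨hx0, hx2⟩ ⟨hy0, hy2⟩ h)
  · refine .inr (inj ⟨hx0, hx2⟩ ⟨by linarith, by linarith⟩ ?_)
    rwa [binEntropy_one_sub]
  · have hxy : 1 - x = y := inj ⟨by linarith, by linarith⟩ ⟨hy0, hy2⟩
      (by rwa [binEntropy_one_sub])
    right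
    linarith
  · exact .inl (binEntropy_strictAntiOn.injOn ⟨hx2, hx1⟩ ⟨hy2, hy1⟩ h)

/-- The GSE of a positive vector on two points is the binary entropy of its escort weight. -/
theorem GSE_two_eq_binEntropy (m : ℝ) {p : Fin 2 → ℝ} (hp : ∀ i, 0 < p i) :
    GSE 2 m p = Real.binEntropy (p 0 ^ m / (p 0 ^ m + p 1 ^ m)) := by
  have h0 := Real.rpow_pos_of_pos (hp 0) m
  have h1 := Real.rpow_pos_of_pos (hp 1) m
  have hc : 1 - p 0 ^ m / (p 0 ^ m + p 1 ^ m) = p 1 ^ m / (p 0 ^ m + p 1 ^ m) := by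
    field_simp
    ring
  rw [Real.binEntropy, hc, Real.log_inv, Real.log_inv]
  simp only [GSE, Fin.sum_univ_two]
  ring

/-- The escort weight of nonzero order determines a positive binary probability vector. -/
theorem eq_of_escort_weight_eq {m a b c d : ℝ} (hm : m ≠ 0) (ha : 0 < a) (hb : 0 < b)
    (hc : 0 < c) (hd : 0 < d) (hab : a + b = 1) (hcd : c + d = 1)
    (h : a ^ m / (a ^ m + b ^ m) = c ^ m / (c ^ m + d ^ m)) : a = c := by
  have ha' := Real.rpow_pos_of_pos ha m
  have hb' := Real.rpow_pos_of_pos hb m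
  have hc' := Real.rpow_pos_of_pos hc m
  have hd' := Real.rpow_pos_of_pos hd m
  rw [div_eq_div_iff (by positivity) (by positivity)] at h
  have hmul : (a * d) ^ m = (c * b) ^ m := by
    rw [Real.mul_rpow ha.le hd.le, Real.mul_rpow hc.le hb.le]
    linarith
  have had := (Real.rpow_left_inj (by positivity) (by positivity) hm).mp hmul
  obtain rfl : b = 1 - a := by linarith
  obtain rfl : d = 1 - c := by linarith
  linarith

/-- For `K = 2` and non-uniform binary distributions, a single positive order
of GSE determines the distribution up to permutation. -/
theorem gse_binary_single_order_sufficient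
    (m : ℝ) (hm : 0 < m)
    (p q : Fin 2 → ℝ)
    (hp : ∀ i, 0 < p i) (hq : ∀ i, 0 < q i)
    (hpsum : ∑ i, p i = 1) (hqsum : ∑ i, q i = 1)
    (hpne : p 0 ≠ p 1) (hqne : q 0 ≠ q 1)
    (hH : GSE 2 m p = GSE 2 m q) :
    (q 0 = p 0 ∧ q 1 = p 1) ∨ (q 0 = p 1 ∧ q 1 = p 0) := by
  rw [Fin.sum_univ_two] at hpsum hqsum
  have hp0 := Real.rpow_pos_of_pos (hp 0) m
  have hp1 := Real.rpow_pos_of_pos (hp 1) m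
  have hq0 := Real.rpow_pos_of_pos (hq 0) m
  have hq1 := Real.rpow_pos_of_pos (hq 1) m
  rw [GSE_two_eq_binEntropy m hp, GSE_two_eq_binEntropy m hq] at hH
  have escort_mem {x y : ℝ} (hx : 0 < x) (hy : 0 < y) : x / (x + y) ∈ Set.Icc (0 : ℝ) 1 :=
    ⟨by positivity, div_le_one_of_le₀ (by linarith) (by positivity)⟩
  rcases Real.eq_or_eq_one_sub_of_binEntropy_eq (escort_mem hp0 hp1) (escort_mem hq0 hq1) hH
    with h | h
  · have := eq_of_escort_weight_eq hm.ne' (hp 0) (hp 1) (hq 0) (hq 1) hpsum hqsum h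
    left
    constructor <;> linarith
  · have hswap : 1 - q 0 ^ m / (q 0 ^ m + q 1 ^ m) = q 1 ^ m / (q 1 ^ m + q 0 ^ m) := by
      field_simp
      ring
    have := eq_of_escort_weight_eq hm.ne' (hp 0) (hp 1) (hq 1) (hq 0) hpsum
      ((add_comm _ _).trans hqsum) (h.trans hswap)
    right
    constructor <;> linarith
end

section
/- Let s ≥ 3, let n_1,…,n_s be positive integers with n_1 + ⋯ + n_s = K, and let M ⊂ (0,∞) be a set of r distinct positive real numbers with r ≤ s−2. Then there exist two distinct tuples a = (a_1,…,a_s) ≠ a' = (a'_1,…,a'_s) with a_1 > ⋯ > a_s > 0, a'_1 > ⋯ > a'_s > 0, ∑_{j=1}^s n_j a_j = 1 = ∑_{j=1}^s n_j a'_j, such that the corresponding probability vectors p (n_j copies of a_j) and p' (n_j copies of a'_j) satisfy H_m(p) = H_m(p') for every m ∈ M. That is, r ≤ s−2 orders of GSE do not suffice to identify a distribution with s distinct probability values. -/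
/-- GSE of order `m` of the probability vector consisting of `n j` copies of `a j`
(for `j = 1, …, s`): `H_m(p) = -∑ j, n j * (a j ^ m / S) * log (a j ^ m / S)` where
`S = ∑ j, n j * a j ^ m`. -/
noncomputable def GSEstratum (s : ℕ) (n : Fin s → ℕ) (m : ℝ) (a : Fin s → ℝ) : ℝ :=
  -∑ j, (n j : ℝ) * (a j ^ m / ∑ i, (n i : ℝ) * a i ^ m) *
      Real.log (a j ^ m / ∑ i, (n i : ℝ) * a i ^ m)

open Topology Filter in
/-- If `g` is `C¹` at `x` with surjective derivative, the level set of `g` through `x` contains an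
injectively and `C¹`-parametrized open piece of the kernel of the derivative. -/
theorem ContDiffAt.exists_parametrization_level_set
    {E F : Type*} [NormedAddCommGroup E] [NormedSpace ℝ E] [CompleteSpace E]
    [NormedAddCommGroup F] [NormedSpace ℝ F] [FiniteDimensional ℝ F]
    {g : E → F} {x : E} (hg : ContDiffAt ℝ 1 g x) (hsurj : (fderiv ℝ g x).range = ⊤)
    {U : Set E} (hU : U ∈ 𝓝 x) :
    ∃ (ψ : (fderiv ℝ g x).ker → E) (V : Set (fderiv ℝ g x).ker), IsOpen V ∧ V.Nonempty ∧
      ContDiffOn ℝ 1 ψ V ∧ Set.MapsTo ψ V U ∧ Set.InjOn ψ V ∧ ∀ z ∈ V, g (ψ z) = g x := by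
  have := FiniteDimensional.complete ℝ F
  have hstrict := hg.hasStrictFDerivAt one_ne_zero
  let φ := hstrict.implicitFunctionDataOfComplemented g _ hsurj
    (fderiv ℝ g x).ker_closedComplemented_of_finiteDimensional_range
  have hpt : φ.pt = x := rfl
  have hleft : φ.leftFun = g := rfl
  have hright : ContDiff ℝ 1 φ.rightFun :=
    (ContinuousLinearMap.contDiff _).comp (contDiff_id.sub contDiff_const)
  have hsmooth := ImplicitFunctionData.contDiffAt_implicitFunction (φ := φ) hg
    hright.contDiffAt one_ne_zero
  let ι : (fderiv ℝ g x).ker → F × (fderiv ℝ g x).ker := fun z => (g x, z)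
  let z₀ := φ.rightFun x
  have hι : Tendsto ι (𝓝 z₀) (𝓝 (φ.prodFun φ.pt)) :=
    (Continuous.prodMk_right (g x)).tendsto z₀
  have hψ : ContDiffAt ℝ 1 (φ.implicitFunction (g x)) z₀ :=
    ContDiffAt.comp (f := ι) z₀ hsmooth (contDiffAt_const.prodMk contDiffAt_id)
  have hψx : φ.implicitFunction (g x) z₀ = x := φ.implicitFunction_apply_image.self_of_nhds
  have hev : ∀ᶠ z in 𝓝 z₀, ContDiffAt ℝ 1 (φ.implicitFunction (g x)) z ∧
      φ.implicitFunction (g x) z ∈ U ∧ φ.prodFun (φ.implicitFunction (g x) z) = ι z :=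
    (hψ.eventually (by simp)).and
      ((hψ.continuousAt.eventually (by rwa [hψx])).and (hι.eventually φ.prodFun_implicitFunction))
  obtain ⟨V, hV, hVo, hzV⟩ := eventually_nhds_iff.1 hev
  refine ⟨φ.implicitFunction (g x), V, hVo, ⟨z₀, hzV⟩, fun z hz => (hV z hz).1.contDiffWithinAt,
    fun z hz => (hV z hz).2.1, fun z hz w hw hzw => ?_, fun z hz => ?_⟩
  · have h := congrArg φ.prodFun hzw
    rw [(hV z hz).2.2, (hV w hw).2.2] at h
    exact congrArg Prod.snd h
  · exact congrArg Prod.fst (hV z hz).2.2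

/-- Fewer than `dim E` real-valued `C¹` functions cannot separate the points of a nonempty open
subset of `E`. -/
theorem exists_ne_forall_eq_of_card_lt_finrank {ι : Type*} (t : Finset ι)
    {E : Type*} [NormedAddCommGroup E] [NormedSpace ℝ E] [FiniteDimensional ℝ E]
    {f : ι → E → ℝ} {U : Set E} (hU : IsOpen U) (hne : U.Nonempty)
    (hf : ∀ i ∈ t, ContDiffOn ℝ 1 (f i) U) (ht : t.card < Module.finrank ℝ E) :
    ∃ x ∈ U, ∃ y ∈ U, x ≠ y ∧ ∀ i ∈ t, f i x = f i y := by
  classical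
  induction t using Finset.induction_on generalizing E with
  | empty =>
    obtain ⟨x, hx⟩ := hne
    have : Nontrivial E := Module.finrank_pos_iff.1 (by simpa using ht)
    obtain ⟨y, hy, hyx⟩ := (infinite_of_mem_nhds x (hU.mem_nhds hx)).nontrivial.exists_ne x
    exact ⟨x, hx, y, hy, hyx.symm, by simp⟩
  | insert i t hi ih =>
    rw [Finset.card_insert_of_notMem hi] at ht
    by_cases hd : ∀ x ∈ U, fderiv ℝ (f i) x = 0
    · obtain ⟨x₀, hx₀⟩ := hne
      obtain ⟨ε, hε, hball⟩ := Metric.isOpen_iff.1 hU x₀ hx₀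
      obtain ⟨x, hx, y, hy, hxy, h⟩ := ih Metric.isOpen_ball ⟨x₀, Metric.mem_ball_self hε⟩
        (fun j hj => (hf j (Finset.mem_insert_of_mem hj)).mono hball) (by omega)
      refine ⟨x, hball hx, y, hball hy, hxy, (Finset.forall_mem_insert _ _ _).2 ⟨?_, h⟩⟩
      exact Metric.isOpen_ball.is_const_of_fderiv_eq_zero (convex_ball x₀ ε).isPreconnected
        (((hf i (Finset.mem_insert_self i t)).differentiableOn one_ne_zero).mono hball)
        (fun z hz => hd z (hball hz)) hx hy
    · push Not at hd
      obtain ⟨x₀, hx₀, hd⟩ := hd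
      have := FiniteDimensional.complete ℝ E
      have hsurj : (fderiv ℝ (f i) x₀).range = ⊤ :=
        LinearMap.range_eq_top.2
          (LinearMap.surjective fun h => hd (ContinuousLinearMap.coe_inj.1 h))
      obtain ⟨ψ, V, hVo, hVne, hψ, hmaps, hinj, hlevel⟩ :=
        ContDiffAt.exists_parametrization_level_set
          ((hf i (Finset.mem_insert_self i t)).contDiffAt (hU.mem_nhds hx₀)) hsurj
          (hU.mem_nhds hx₀)
      have hrank := LinearMap.finrank_range_add_finrank_ker (fderiv ℝ (f i) x₀ : E →ₗ[ℝ] ℝ)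
      rw [hsurj, finrank_top, Module.finrank_self] at hrank
      obtain ⟨x, hx, y, hy, hxy, h⟩ := ih (f := fun j => f j ∘ ψ) hVo hVne
        (fun j hj => (hf j (Finset.mem_insert_of_mem hj)).comp hψ hmaps) (by omega)
      exact ⟨ψ x, hmaps hx, ψ y, hmaps hy, hinj.ne hx hy hxy,
        (Finset.forall_mem_insert _ _ _).2 ⟨(hlevel x hx).trans (hlevel y hy).symm, h⟩⟩

theorem sum_natCast_mul_pos {ι : Type*} [Fintype ι] [Nonempty ι] {n : ι → ℕ} (hn : ∀ j, 0 < n j)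
    {b : ι → ℝ} (hb : ∀ j, 0 < b j) : 0 < ∑ j, (n j : ℝ) * b j :=
  Finset.sum_pos (fun j _ => mul_pos (Nat.cast_pos.2 (hn j)) (hb j)) Finset.univ_nonempty

theorem isOpen_setOf_strictAnti_pos_s5 (s : ℕ) :
    IsOpen {a : Fin s → ℝ | StrictAnti a ∧ ∀ j, 0 < a j} := by
  simp only [StrictAnti, Set.ofPred_and, Set.ofPred_forall]
  refine IsOpen.inter ?_ (isOpen_iInter_of_finite fun j =>
    isOpen_lt continuous_const (continuous_apply j))
  exact isOpen_iInter_of_finite fun i => isOpen_iInter_of_finite fun j =>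
    isOpen_iInter_of_finite fun _ => isOpen_lt (continuous_apply j) (continuous_apply i)

theorem GSEstratum_contDiffOn {s : ℕ} [NeZero s] {n : Fin s → ℕ} (hn : ∀ j, 0 < n j) (m : ℝ) :
    ContDiffOn ℝ 1 (GSEstratum s n m) {a | ∀ j, 0 < a j} := by
  intro a ha
  refine ContDiffAt.contDiffWithinAt ?_
  have hpow (j) : ContDiffAt ℝ 1 (fun a : Fin s → ℝ => a j ^ m) a :=
    (contDiff_apply ℝ ℝ j).contDiffAt.rpow_const_of_ne (ha j).ne'
  have hS : 0 < ∑ i, (n i : ℝ) * a i ^ m :=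
    sum_natCast_mul_pos hn fun j => Real.rpow_pos_of_pos (ha j) m
  have hq (j) : ContDiffAt ℝ 1
      (fun a : Fin s → ℝ => a j ^ m / ∑ i, (n i : ℝ) * a i ^ m) a :=
    (hpow j).div (ContDiffAt.sum fun i _ => contDiffAt_const.mul (hpow i)) hS.ne'
  exact (ContDiffAt.sum fun j _ => (contDiffAt_const.mul (hq j)).mul
    ((hq j).log (div_pos (Real.rpow_pos_of_pos (ha j) m) hS).ne')).neg

theorem GSEstratum_div_const {s : ℕ} (n : Fin s → ℕ) (m : ℝ) {a : Fin s → ℝ}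
    (ha : ∀ j, 0 < a j) {c : ℝ} (hc : 0 < c) :
    GSEstratum s n m (fun j => a j / c) = GSEstratum s n m a := by
  have h (j) : (a j / c) ^ m / ∑ i, (n i : ℝ) * (a i / c) ^ m =
      a j ^ m / ∑ i, (n i : ℝ) * a i ^ m := by
    simp only [Real.div_rpow (ha _).le hc.le, ← mul_div_assoc, ← Finset.sum_div]
    exact div_div_div_cancel_right₀ (Real.rpow_pos_of_pos hc m).ne' _ _
  simp only [GSEstratum, h]

/-- for a multiplicity structure with `s ≥ 3` distinct values, `r ≤ s - 2`
distinct positive orders of GSE do not suffice to identify the distribution: two distinct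
strictly decreasing positive value-tuples on the stratum share all GSE values in `M`. -/
theorem gse_multiplicity_necessary
    (s K r : ℕ) (hs : 3 ≤ s)
    (n : Fin s → ℕ) (hn : ∀ j, 0 < n j) (hnK : ∑ j, n j = K)
    (M : Finset ℝ) (hMpos : ∀ m ∈ M, 0 < m) (hMcard : M.card = r) (hr : r ≤ s - 2) :
    ∃ a a' : Fin s → ℝ,
      a ≠ a' ∧
      StrictAnti a ∧ StrictAnti a' ∧
      (∀ j, 0 < a j) ∧ (∀ j, 0 < a' j) ∧
      (∑ j, (n j : ℝ) * a j = 1) ∧ (∑ j, (n j : ℝ) * a' j = 1) ∧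
      (∀ m ∈ M, GSEstratum s n m a = GSEstratum s n m a') := by
  have : NeZero s := ⟨by omega⟩
  let f : Option ℝ → (Fin s → ℝ) → ℝ := fun o a =>
    o.elim (∑ j, (n j : ℝ) * a j) fun m => GSEstratum s n m a
  have hne : {a : Fin s → ℝ | StrictAnti a ∧ ∀ j, 0 < a j}.Nonempty :=
    ⟨fun j => (s : ℝ) - j, fun i j hij => sub_lt_sub_left (by exact_mod_cast hij) _,
      fun j => sub_pos.2 (by exact_mod_cast j.2)⟩
  have hf : ∀ o ∈ M.insertNone,
      ContDiffOn ℝ 1 (f o) {a : Fin s → ℝ | StrictAnti a ∧ ∀ j, 0 < a j} :=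
    Finset.forall_mem_insertNone.2
      ⟨(ContDiff.sum fun j _ => contDiff_const.mul (contDiff_apply ℝ ℝ j)).contDiffOn,
        fun m _ => (GSEstratum_contDiffOn hn m).mono fun _ ha => ha.2⟩
  obtain ⟨a, ⟨ha, hapos⟩, b, ⟨hb, hbpos⟩, hab, h⟩ := exists_ne_forall_eq_of_card_lt_finrank
    M.insertNone (isOpen_setOf_strictAnti_pos_s5 s) hne hf
    (by rw [Finset.card_insertNone, Module.finrank_fin_fun]; omega)
  obtain ⟨hsum, hgse⟩ := Finset.forall_mem_insertNone.1 h
  set c := ∑ j, (n j : ℝ) * a j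
  have hc : 0 < c := sum_natCast_mul_pos hn hapos
  have hcb : ∑ j, (n j : ℝ) * b j = c := hsum.symm
  refine ⟨fun j => a j / c, fun j => b j / c, fun heq => hab (funext fun j => ?_),
    fun i j hij => div_lt_div_of_pos_right (ha hij) hc,
    fun i j hij => div_lt_div_of_pos_right (hb hij) hc,
    fun j => div_pos (hapos j) hc, fun j => div_pos (hbpos j) hc, ?_, ?_, fun m hm => ?_⟩
  · exact (div_left_inj' hc.ne').1 (congrFun heq j)
  · simp only [← mul_div_assoc, ← Finset.sum_div]
    exact div_self hc.ne'
  · simp only [← mul_div_assoc, ← Finset.sum_div, hcb]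
    exact div_self hc.ne'
  · rw [GSEstratum_div_const n m hapos hc, GSEstratum_div_const n m hbpos hc]
    exact hgse m hm
end
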